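/- arXiv:0712.2246 — 6 statements merged into one kernel-verified Lean document; each statement's English description precedes it below -/
import Mathlib

section
/- Let P = {P_1,…,P_m} be a system of coordinate projections in M_n(ℂ) with rank(P_i) = d(i) and let C_P be the induced compression. Let S ∈ M_n(ℂ) be positive semidefinite and let S_i ∈ M_{d(i)}(ℂ) be positive semidefinite for 1 ≤ i ≤ m. Then the following are equivalent: (1) there exists a contraction V ∈ M_n(ℂ) with C_P(V*SV) = ⊕_{i=1}^m S_i; (2) there exist unitary matrices V_1,…,V_m ∈ U(n) such that S ≥ Σ_{i=1}^m V_i*(⊕_{j=1}^m δ_{ij} S_j)V_i in the Loewner order, where ⊕_{j=1}^m δ_{ij} S_j ∈ M_n(ℂ) denotes the block-diagonal matrix whose i-th diagonal block is S_i and whose other diagonal blocks are zero; (3) there exist a contraction W ∈ M_n(ℂ) and unitary matrices V_1,…,V_m ∈ U(n) such that W*SW = Σ_{i=1}^m V_i*(⊕_{j=1}^m δ_{ij} S_j)V_i. -/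
open Matrix
open scoped ComplexOrder

/-- `V` is a contraction: its operator norm on `ℓ²` is at most 1. -/
noncomputable def IsContraction {ι : Type*} [Fintype ι] [DecidableEq ι]
    (V : Matrix ι ι ℂ) : Prop :=
  ∀ x : EuclideanSpace ℂ ι, ‖Matrix.toEuclideanLin V x‖ ≤ ‖x‖

/-- The `i`-th coordinate projection of the system encoded by the block-index
function `g : Fin n → Fin m` (monotone and surjective `g` corresponds to a
partition of `{1,…,n}` into `m` consecutive intervals). -/
def coordProj {n m : ℕ} (g : Fin n → Fin m) (i : Fin m) :
    Matrix (Fin n) (Fin n) ℂ :=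
  Matrix.diagonal fun k => if g k = i then 1 else 0

/-- The compression `C_P(X) = Σ_i P_i X P_i` induced by the system of
coordinate projections encoded by `g`. -/
noncomputable def coordCompress {n m : ℕ} (g : Fin n → Fin m)
    (X : Matrix (Fin n) (Fin n) ℂ) : Matrix (Fin n) (Fin n) ℂ :=
  ∑ i : Fin m, coordProj g i * X * coordProj g i

/-- The nonincreasing rearrangement `x↓` of a vector `x ∈ ℝ^n`. -/
noncomputable def sortedVec {n : ℕ} (x : Fin n → ℝ) : Fin n → ℝ :=
  fun i => ((Multiset.map x Finset.univ.val).sort (· ≥ ·)).get (Fin.cast (by simp) i)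

/-- Vector majorization `x ≺ y`. -/
noncomputable def Majorizes {n : ℕ} (x y : Fin n → ℝ) : Prop :=
  (∀ k : ℕ, k ≤ n →
      ∑ i ∈ Finset.univ.filter (fun i : Fin n => (i : ℕ) < k), sortedVec x i ≤
        ∑ i ∈ Finset.univ.filter (fun i : Fin n => (i : ℕ) < k), sortedVec y i) ∧
    ∑ i, x i = ∑ i, y i

/-- `f(A)` for a hermitian matrix `A`, via the spectral theorem. -/
noncomputable def matFun {n : ℕ} {A : Matrix (Fin n) (Fin n) ℂ}
    (hA : A.IsHermitian) (f : ℝ → ℝ) : Matrix (Fin n) (Fin n) ℂ :=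
  (hA.eigenvectorUnitary : Matrix (Fin n) (Fin n) ℂ) *
    Matrix.diagonal (fun i => (f (hA.eigenvalues i) : ℂ)) *
    star (hA.eigenvectorUnitary : Matrix (Fin n) (Fin n) ℂ)

section ContractionFactorization

variable {ι : Type*} [Fintype ι] [DecidableEq ι]

open scoped MatrixOrder in
lemma exists_isHermitian_mul_self_eq {S : Matrix ι ι ℂ} (hS : S.PosSemidef) :
    ∃ Q : Matrix ι ι ℂ, Qᴴ = Q ∧ Q * Q = S :=
  ⟨CFC.sqrt S, (nonneg_iff_posSemidef.1 (CFC.sqrt_nonneg S)).isHermitian,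
    CFC.sqrt_mul_sqrt_self S (nonneg_iff_posSemidef.2 hS)⟩

lemma norm_sq_toEuclideanLin (A : Matrix ι ι ℂ) (x : EuclideanSpace ℂ ι) :
    RCLike.re (inner ℂ (toEuclideanLin (Aᴴ * A) x) x) = ‖toEuclideanLin A x‖ ^ 2 := by
  rw [toLpLin_mul 2 2 2, toEuclideanLin_conjTranspose_eq_adjoint, LinearMap.comp_apply,
    LinearMap.adjoint_inner_left, inner_self_eq_norm_sq]

lemma posSemidef_sub_iff_norm_le (Q A : Matrix ι ι ℂ) :
    (Qᴴ * Q - Aᴴ * A).PosSemidef ↔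
      ∀ x, ‖toEuclideanLin A x‖ ≤ ‖toEuclideanLin Q x‖ := by
  rw [← isPositive_toEuclideanLin_iff, LinearMap.IsPositive, isSymmetric_toEuclideanLin_iff]
  have hsymm : (Qᴴ * Q - Aᴴ * A).IsHermitian :=
    (isHermitian_conjTranspose_mul_self Q).sub (isHermitian_conjTranspose_mul_self A)
  simp only [hsymm, true_and]
  refine forall_congr' fun x => ?_
  rw [map_sub, LinearMap.sub_apply, inner_sub_left, map_sub, norm_sq_toEuclideanLin,
    norm_sq_toEuclideanLin, sub_nonneg, sq_le_sq₀ (norm_nonneg _) (norm_nonneg _)]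

lemma IsContraction.conjTranspose {V : Matrix ι ι ℂ} (hV : IsContraction V) :
    IsContraction Vᴴ := by
  intro x
  by_contra! h
  set y := toEuclideanLin Vᴴ x
  have hy : 0 < ‖y‖ := (norm_nonneg x).trans_lt h
  have key : ‖y‖ ^ 2 ≤ ‖x‖ * ‖y‖ := by
    rw [← inner_self_eq_norm_sq (𝕜 := ℂ)]
    have hadj : y = LinearMap.adjoint (toEuclideanLin V) x := by
      rw [← toEuclideanLin_conjTranspose_eq_adjoint]
    calc RCLike.re (inner ℂ y y)
        = RCLike.re (inner ℂ (toEuclideanLin V y) x) := by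
          rw [← LinearMap.adjoint_inner_right (toEuclideanLin V), ← hadj]
      _ ≤ ‖toEuclideanLin V y‖ * ‖x‖ := re_inner_le_norm _ _
      _ ≤ ‖y‖ * ‖x‖ := by gcongr; exact hV y
      _ = ‖x‖ * ‖y‖ := mul_comm _ _
  nlinarith

lemma IsContraction.mul {V W : Matrix ι ι ℂ} (hV : IsContraction V) (hW : IsContraction W) :
    IsContraction (V * W) := fun x => by
  rw [toLpLin_mul 2 2 2, LinearMap.comp_apply]
  exact (hV _).trans (hW x)

lemma isContraction_of_mem_unitaryGroup {U : Matrix ι ι ℂ} (hU : U ∈ unitaryGroup ι ℂ) :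
    IsContraction U := fun x => by
  have h := norm_sq_toEuclideanLin U x
  have hU' : Uᴴ * U = 1 := mem_unitaryGroup_iff'.1 hU
  rw [hU', toLpLin_one, LinearMap.id_apply, inner_self_eq_norm_sq] at h
  exact ((sq_eq_sq₀ (norm_nonneg _) (norm_nonneg _)).1 h).ge

/-- Douglas factorization. -/
lemma posSemidef_sub_iff_exists_contraction (Q A : Matrix ι ι ℂ) :
    (Q * Qᴴ - A * Aᴴ).PosSemidef ↔ ∃ V, IsContraction V ∧ A = Q * V := by
  have hiff := posSemidef_sub_iff_norm_le Qᴴ Aᴴ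
  rw [conjTranspose_conjTranspose, conjTranspose_conjTranspose] at hiff
  rw [hiff]
  constructor
  · intro h
    set q := toEuclideanLin Qᴴ
    set a := toEuclideanLin Aᴴ
    obtain ⟨s, hs⟩ := q.rangeRestrict.exists_rightInverse_of_surjective q.range_rangeRestrict
    have hqs : ∀ y, q (s y) = y := fun y => congrArg Subtype.val (LinearMap.congr_fun hs y)
    let k : EuclideanSpace ℂ ι →ₗ[ℂ] EuclideanSpace ℂ ι :=
      a ∘ₗ s ∘ₗ q.range.orthogonalProjectionOnto.toLinearMap
    have hk : ∀ y, ‖k y‖ ≤ ‖y‖ := fun y =>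
      calc ‖k y‖ ≤ ‖q (s (q.range.orthogonalProjectionOnto y))‖ := h _
        _ = ‖q.range.orthogonalProjectionOnto y‖ := by rw [hqs]; rfl
        _ ≤ ‖y‖ := q.range.norm_orthogonalProjectionOnto_apply_le y
    have hkq : k ∘ₗ q = a := by
      ext1 x
      have hp : q.range.orthogonalProjectionOnto (q x) = ⟨q x, x, rfl⟩ :=
        Submodule.orthogonalProjectionOnto_mem_subspace_eq_self (⟨q x, x, rfl⟩ : q.range)
      have h0 := h (s ⟨q x, x, rfl⟩ - x)
      change ‖a _‖ ≤ ‖q _‖ at h0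
      rw [map_sub, map_sub, hqs, sub_self, norm_zero, norm_le_zero_iff, sub_eq_zero] at h0
      change a (s (q.range.orthogonalProjectionOnto (q x))) = a x
      rw [hp, h0]
    have hK : IsContraction (toEuclideanLin.symm k) := fun x => by
      rw [LinearEquiv.apply_symm_apply]; exact hk x
    refine ⟨_, hK.conjTranspose, ?_⟩
    have hA : Aᴴ = toEuclideanLin.symm k * Qᴴ := by
      apply toEuclideanLin.injective
      rw [toLpLin_mul 2 2 2, LinearEquiv.apply_symm_apply]
      exact hkq.symm
    simpa using congrArg Matrix.conjTranspose hA
  · rintro ⟨V, hV, rfl⟩ x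
    rw [conjTranspose_mul, toLpLin_mul 2 2 2, LinearMap.comp_apply]
    exact hV.conjTranspose _

lemma exists_unitary_mul_conjTranspose_eq (B : Matrix ι ι ℂ) :
    ∃ U ∈ unitaryGroup ι ℂ, B * Bᴴ = Uᴴ * (Bᴴ * B) * U := by
  have h₁ := isHermitian_mul_conjTranspose_self B
  have h₂ := isHermitian_conjTranspose_mul_self B
  have he : h₁.eigenvalues = h₂.eigenvalues :=
    (h₁.eigenvalues_eq_eigenvalues_iff h₂).2 (charpoly_mul_comm _ _)
  have s₁ := h₁.spectral_theorem
  have s₂ := h₂.spectral_theorem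
  rw [Unitary.conjStarAlgAut_apply, he] at s₁
  rw [Unitary.conjStarAlgAut_apply] at s₂
  set D : Matrix ι ι ℂ := diagonal (RCLike.ofReal ∘ h₂.eigenvalues)
  set U₁ := h₁.eigenvectorUnitary
  set U₂ := h₂.eigenvectorUnitary
  refine ⟨(U₂ * star U₁ : unitaryGroup ι ℂ), SetLike.coe_mem _, ?_⟩
  rw [s₁, s₂]
  have hU : star (U₂ : Matrix ι ι ℂ) * U₂ = 1 := Unitary.coe_star_mul_self U₂
  simp only [← star_eq_conjTranspose, Submonoid.coe_mul, Unitary.coe_star, star_mul, star_star]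
  calc _ = (U₁ : Matrix ι ι ℂ) * 1 * D * 1 * star (U₁ : Matrix ι ι ℂ) := by
        rw [Matrix.mul_one, Matrix.mul_one]
    _ = _ := by rw [← hU]; simp only [Matrix.mul_assoc]

end ContractionFactorization

lemma coordProj_mul_coordProj {n m : ℕ} (g : Fin n → Fin m) (i j : Fin m) :
    coordProj g i * coordProj g j = if i = j then coordProj g i else 0 := by
  unfold coordProj
  rw [diagonal_mul_diagonal]
  split_ifs with h
  · subst h; simp
  · rw [← diagonal_zero]
    congr 1
    ext k
    by_cases hk : g k = i
    · simp [hk, h]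
    · simp [hk]

lemma conjTranspose_coordProj {n m : ℕ} (g : Fin n → Fin m) (i : Fin m) :
    (coordProj g i)ᴴ = coordProj g i := by
  unfold coordProj
  rw [diagonal_conjTranspose]
  congr 1
  ext k
  simp [apply_ite]

lemma sum_coordProj {n m : ℕ} (g : Fin n → Fin m) : ∑ i, coordProj g i = 1 := by
  ext k l
  simp only [coordProj, Matrix.sum_apply, diagonal_apply, one_apply]
  split_ifs <;> simp

lemma coordProj_conj_coordCompress {n m : ℕ} (g : Fin n → Fin m) (X : Matrix (Fin n) (Fin n) ℂ)
    (i : Fin m) :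
    coordProj g i * coordCompress g X * coordProj g i = coordProj g i * X * coordProj g i := by
  unfold coordCompress
  rw [Finset.mul_sum, Finset.sum_mul, Finset.sum_eq_single i]
  · have h := coordProj_mul_coordProj g i i
    rw [if_pos rfl] at h
    simp only [Matrix.mul_assoc, h]
    simp only [← Matrix.mul_assoc, h]
  · intro j _ hj
    have h := coordProj_mul_coordProj g i j
    rw [if_neg hj.symm] at h
    simp [← Matrix.mul_assoc, h]
  · simp

/-- Sums of unitary conjugates of the blocks of `T` are exactly the matrices `A * Aᴴ` where `A`
has Gram matrix `Aᴴ * A` with the same diagonal blocks as `T`. -/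
lemma exists_sum_unitary_conj_eq_iff {n m : ℕ} (g : Fin n → Fin m)
    {T : Matrix (Fin n) (Fin n) ℂ}
    (hT : ∀ i, (coordProj g i * T * coordProj g i).PosSemidef) (R : Matrix (Fin n) (Fin n) ℂ) :
    (∃ V : Fin m → Matrix (Fin n) (Fin n) ℂ, (∀ i, V i ∈ unitaryGroup (Fin n) ℂ) ∧
        R = ∑ i, (V i)ᴴ * (coordProj g i * T * coordProj g i) * V i) ↔
      ∃ A : Matrix (Fin n) (Fin n) ℂ, R = A * Aᴴ ∧
        ∀ i, coordProj g i * (Aᴴ * A) * coordProj g i = coordProj g i * T * coordProj g i := by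
  have hP := coordProj_mul_coordProj g
  constructor
  · rintro ⟨V, hV, rfl⟩
    have hB : ∀ i, ∃ C : Matrix (Fin n) (Fin n) ℂ, C * coordProj g i = C ∧
        Cᴴ * C = coordProj g i * T * coordProj g i ∧
        C * Cᴴ = (V i)ᴴ * (coordProj g i * T * coordProj g i) * V i := by
      intro i
      obtain ⟨B, hBs, hB⟩ := exists_isHermitian_mul_self_eq (hT i)
      obtain ⟨U, hU, hBU⟩ := exists_unitary_mul_conjTranspose_eq (B * coordProj g i)
      have hBP : (B * coordProj g i)ᴴ * (B * coordProj g i) =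
          coordProj g i * T * coordProj g i := by
        have h := hP i i
        rw [if_pos rfl] at h
        calc _ = coordProj g i * (Bᴴ * B) * coordProj g i := by
              simp only [conjTranspose_mul, conjTranspose_coordProj, Matrix.mul_assoc]
          _ = _ := by
              rw [hBs, hB]
              simp only [Matrix.mul_assoc, h]
              simp only [← Matrix.mul_assoc, h]
      have hUU : Uᴴ * U = 1 := mem_unitaryGroup_iff'.1 hU
      have hUU' : U * Uᴴ = 1 := mem_unitaryGroup_iff.1 hU
      have hVV : V i * (V i)ᴴ = 1 := mem_unitaryGroup_iff.1 (hV i)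
      set D := B * coordProj g i with hD
      refine ⟨(V i)ᴴ * U * D, ?_, ?_, ?_⟩
      · have h := hP i i
        rw [if_pos rfl] at h
        simp only [hD, Matrix.mul_assoc, h]
      · calc _ = Dᴴ * (Uᴴ * (V i * (V i)ᴴ) * U) * D := by
              simp only [conjTranspose_mul, conjTranspose_conjTranspose, Matrix.mul_assoc]
          _ = _ := by rw [hVV, Matrix.mul_one, hUU, Matrix.mul_one, hBP]
      · calc _ = (V i)ᴴ * (U * (D * Dᴴ) * Uᴴ) * V i := by
              simp only [conjTranspose_mul, conjTranspose_conjTranspose, Matrix.mul_assoc]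
          _ = (V i)ᴴ * ((U * Uᴴ) * (Dᴴ * D) * (U * Uᴴ)) * V i := by
              rw [hBU]; simp only [Matrix.mul_assoc]
          _ = _ := by rw [hUU', Matrix.one_mul, Matrix.mul_one, hBP]
    choose C hCP hC hC' using hB
    have hcross : ∀ i j, i ≠ j → C i * (C j)ᴴ = 0 := fun i j hij => by
      rw [← hCP i, ← hCP j, conjTranspose_mul, conjTranspose_coordProj]
      calc _ = C i * (coordProj g i * coordProj g j) * (C j)ᴴ := by simp only [Matrix.mul_assoc]
        _ = 0 := by rw [hP, if_neg hij, Matrix.mul_zero, Matrix.zero_mul]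
    have hAP : ∀ i, (∑ j, C j) * coordProj g i = C i := fun i => by
      rw [Finset.sum_mul, Finset.sum_eq_single i]
      · exact hCP i
      · intro j _ hj
        rw [← hCP j, Matrix.mul_assoc, hP, if_neg hj, Matrix.mul_zero]
      · simp
    refine ⟨∑ i, C i, ?_, fun i => ?_⟩
    · rw [conjTranspose_sum, Finset.sum_mul]
      refine Finset.sum_congr rfl fun i _ => ?_
      rw [Finset.mul_sum, Finset.sum_eq_single i, hC']
      · exact fun j _ hj => hcross i j hj.symm
      · simp
    · rw [← hC i, ← hAP i]
      simp only [conjTranspose_mul, conjTranspose_coordProj, Matrix.mul_assoc]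
  · rintro ⟨A, rfl, hA⟩
    choose U hU hBU using fun i => exists_unitary_mul_conjTranspose_eq (A * coordProj g i)
    refine ⟨U, hU, ?_⟩
    calc A * Aᴴ = A * (∑ i, coordProj g i) * Aᴴ := by rw [sum_coordProj, Matrix.mul_one]
      _ = ∑ i, A * coordProj g i * Aᴴ := by rw [Finset.mul_sum, Finset.sum_mul]
      _ = _ := Finset.sum_congr rfl fun i _ => ?_
    have h := hP i i
    rw [if_pos rfl] at h
    have h₁ : A * coordProj g i * (A * coordProj g i)ᴴ = A * coordProj g i * Aᴴ := by
      rw [conjTranspose_mul, conjTranspose_coordProj, ← Matrix.mul_assoc, Matrix.mul_assoc A, h]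
    have h₂ : (A * coordProj g i)ᴴ * (A * coordProj g i) =
        coordProj g i * (Aᴴ * A) * coordProj g i := by
      simp only [conjTranspose_mul, conjTranspose_coordProj, Matrix.mul_assoc]
    rw [← hA i, ← h₂, ← hBU i, h₁]

lemma coordCompress_eq_iff {n m : ℕ} {g : Fin n → Fin m} {T : Matrix (Fin n) (Fin n) ℂ}
    (hT : coordCompress g T = T) (X : Matrix (Fin n) (Fin n) ℂ) :
    coordCompress g X = T ↔
      ∀ i, coordProj g i * X * coordProj g i = coordProj g i * T * coordProj g i := by
  constructor
  · rintro rfl i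
    rw [coordProj_conj_coordCompress]
  · intro h
    rw [← hT]
    exact Finset.sum_congr rfl fun i _ => h i

/-- Theorem: NC contractive Schur–Horn for block diagonal
compressions.  The block-diagonal matrix `⊕_i S_i` is encoded as a matrix
`T ∈ M_n(ℂ)` fixed by the compression `C_P`, whose `i`-th diagonal block is
`P_i T P_i` (so "`S_i` is positive semidefinite" reads
`(P_i T P_i).PosSemidef`). -/
theorem stmt_0 {n m : ℕ} (g : Fin n → Fin m) (hg_mono : Monotone g)
    (hg_surj : Function.Surjective g)
    (S : Matrix (Fin n) (Fin n) ℂ) (hS : S.PosSemidef)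
    (T : Matrix (Fin n) (Fin n) ℂ) (hT : coordCompress g T = T)
    (hTblocks : ∀ i : Fin m, (coordProj g i * T * coordProj g i).PosSemidef) :
    ((∃ V : Matrix (Fin n) (Fin n) ℂ, IsContraction V ∧
        coordCompress g (Vᴴ * S * V) = T) ↔
      (∃ V : Fin m → Matrix (Fin n) (Fin n) ℂ,
        (∀ i, V i ∈ Matrix.unitaryGroup (Fin n) ℂ) ∧
        (S - ∑ i : Fin m,
          (V i)ᴴ * (coordProj g i * T * coordProj g i) * V i).PosSemidef)) ∧
    ((∃ V : Fin m → Matrix (Fin n) (Fin n) ℂ,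
        (∀ i, V i ∈ Matrix.unitaryGroup (Fin n) ℂ) ∧
        (S - ∑ i : Fin m,
          (V i)ᴴ * (coordProj g i * T * coordProj g i) * V i).PosSemidef) ↔
      (∃ W : Matrix (Fin n) (Fin n) ℂ, IsContraction W ∧
        ∃ V : Fin m → Matrix (Fin n) (Fin n) ℂ,
          (∀ i, V i ∈ Matrix.unitaryGroup (Fin n) ℂ) ∧
          Wᴴ * S * W = ∑ i : Fin m,
            (V i)ᴴ * (coordProj g i * T * coordProj g i) * V i)) := by
  obtain ⟨Q, hQs, hQ⟩ := exists_isHermitian_mul_self_eq hS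
  have hgram : ∀ V : Matrix (Fin n) (Fin n) ℂ, Vᴴ * S * V = (Q * V)ᴴ * (Q * V) := fun V => by
    simp only [← hQ, conjTranspose_mul, hQs, Matrix.mul_assoc]
  have hdouglas : ∀ A : Matrix (Fin n) (Fin n) ℂ,
      (S - A * Aᴴ).PosSemidef ↔ ∃ V, IsContraction V ∧ A = Q * V := fun A => by
    rw [← posSemidef_sub_iff_exists_contraction, hQs, hQ]
  have hsum := exists_sum_unitary_conj_eq_iff g hTblocks
  constructor
  · constructor
    · rintro ⟨V, hV, hVT⟩
      rw [coordCompress_eq_iff hT, hgram] at hVT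
      obtain ⟨U, hU, hUV⟩ := (hsum _).2 ⟨Q * V, rfl, hVT⟩
      exact ⟨U, hU, hUV ▸ (hdouglas _).2 ⟨V, hV, rfl⟩⟩
    · rintro ⟨U, hU, hle⟩
      obtain ⟨A, hA, hAT⟩ := (hsum _).1 ⟨U, hU, rfl⟩
      rw [hA] at hle
      obtain ⟨V, hV, rfl⟩ := (hdouglas A).1 hle
      refine ⟨V, hV, ?_⟩
      rwa [coordCompress_eq_iff hT, hgram]
  · constructor
    · rintro ⟨U, hU, hle⟩
      obtain ⟨A, hA, -⟩ := (hsum _).1 ⟨U, hU, rfl⟩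
      rw [hA] at hle
      obtain ⟨V, hV, rfl⟩ := (hdouglas A).1 hle
      obtain ⟨Z, hZ, hZV⟩ := exists_unitary_mul_conjTranspose_eq (Q * V)
      refine ⟨V * Z, hV.mul (isContraction_of_mem_unitaryGroup hZ), U, hU, ?_⟩
      rw [hA, hZV, ← hgram]
      simp only [conjTranspose_mul, Matrix.mul_assoc]
    · rintro ⟨W, hW, U, hU, hWU⟩
      obtain ⟨Z, hZ, hZW⟩ := exists_unitary_mul_conjTranspose_eq (Q * W)
      refine ⟨fun i => U i * Z, fun i => mul_mem (hU i) hZ, ?_⟩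
      have hconj : ∑ i, (U i * Z)ᴴ * (coordProj g i * T * coordProj g i) * (U i * Z) =
          (Q * W) * (Q * W)ᴴ := by
        rw [hZW, ← hgram, hWU, Finset.mul_sum, Finset.sum_mul]
        simp only [conjTranspose_mul, Matrix.mul_assoc]
      rw [hconj]
      exact (hdouglas _).2 ⟨W, hW, rfl⟩
end

section
/- Let P = {P_1,…,P_m} be a system of coordinate projections in M_n(ℂ) with rank(P_i) = d(i) and let C_P be the induced compression. Then the following are equivalent: (1) for every positive semidefinite S ∈ M_n(ℂ), the set C_P(U_n(S)) = {C_P(U*SU) : U ∈ U(n)} is a convex subset of M_n(ℂ); (2) d(i) = 1 for every 1 ≤ i ≤ m (and hence m = n). -/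
open Matrix
open scoped ComplexOrder

theorem coordCompress_apply {n m : ℕ} (g : Fin n → Fin m) (X : Matrix (Fin n) (Fin n) ℂ)
    (a b : Fin n) : coordCompress g X a b = if g a = g b then X a b else 0 := by
  simp only [coordCompress, coordProj, Matrix.sum_apply, Matrix.mul_diagonal,
    Matrix.diagonal_mul]
  rw [Finset.sum_eq_single (g a)]
  · by_cases h : g a = g b <;> simp [h, eq_comm]
  · intro i _ hi
    simp [hi.symm]
  · simp

/-- `x` is the diagonal of a matrix unitarily equivalent to `S`. -/
def IsOrbitDiag {n : ℕ} (S : Matrix (Fin n) (Fin n) ℂ) (x : Fin n → ℝ) : Prop :=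
  ∃ U ∈ Matrix.unitaryGroup (Fin n) ℂ, ∀ a, (Uᴴ * S * U) a a = (x a : ℂ)

theorem conjTranspose_mul_mul_apply {n : ℕ} (U M : Matrix (Fin n) (Fin n) ℂ) (a b : Fin n) :
    (Uᴴ * M * U) a b = star (Uᵀ a) ⬝ᵥ M *ᵥ Uᵀ b := by
  rw [Matrix.mul_assoc]
  rfl

theorem IsOrbitDiag.comp_perm {n : ℕ} {S : Matrix (Fin n) (Fin n) ℂ} {x : Fin n → ℝ}
    (h : IsOrbitDiag S x) (σ : Equiv.Perm (Fin n)) : IsOrbitDiag S (x ∘ σ) := by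
  obtain ⟨U, hU, hx⟩ := h
  refine ⟨U.submatrix id σ, ?_, fun a => ?_⟩
  · rw [Matrix.mem_unitaryGroup_iff'] at hU ⊢
    ext a b
    have := congrFun₂ hU (σ a) (σ b)
    simpa [Matrix.mul_apply, Matrix.one_apply] using this
  · exact hx (σ a)

theorem exists_unit_mul_add_conj_eq_zero (z : ℂ) :
    ∃ w : ℂ, star w * w = 1 ∧ w * z + star w * star z = 0 := by
  by_cases hz : z = 0
  · exact ⟨1, by simp, by simp [hz]⟩
  · have hn : (‖z‖ : ℂ) ≠ 0 := by simpa using hz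
    have h2 : star z * z = (‖z‖ : ℂ) ^ 2 := by
      simpa [mul_comm] using Complex.mul_conj' z
    refine ⟨Complex.I * star z / ‖z‖, ?_, ?_⟩
    · simp only [Complex.star_def] at h2
      simp only [Complex.star_def, map_div₀, map_mul, Complex.conj_I, Complex.conj_conj,
        Complex.conj_ofReal]
      field_simp
      linear_combination h2 - z * (starRingEnd ℂ) z * Complex.I_sq
    · simp only [Complex.star_def, map_div₀, map_mul, Complex.conj_I, Complex.conj_conj,
        Complex.conj_ofReal]
      field_simp
      ring

/-- A plane rotation of an orthonormal basis realizes every T-transform of the diagonal. -/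
theorem IsOrbitDiag.transform {n : ℕ} {S : Matrix (Fin n) (Fin n) ℂ} (hS : S.IsHermitian)
    {x : Fin n → ℝ} (h : IsOrbitDiag S x) {j k : Fin n} (hjk : j ≠ k) {t : ℝ}
    (ht0 : 0 ≤ t) (ht1 : t ≤ 1) {y : Fin n → ℝ}
    (hj : y j = (1 - t) * x j + t * x k) (hk : y k = t * x j + (1 - t) * x k)
    (hy : ∀ a, a ≠ j → a ≠ k → y a = x a) : IsOrbitDiag S y := by
  obtain ⟨U, hU, hx⟩ := h
  obtain ⟨w, hw, hwz⟩ := exists_unit_mul_add_conj_eq_zero ((Uᴴ * S * U) j k)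
  have hkj : (Uᴴ * S * U) k j = star ((Uᴴ * S * U) j k) := by
    rw [← Matrix.conjTranspose_apply, (Matrix.isHermitian_conjTranspose_mul_mul U hS).eq]
  rw [← hkj] at hwz
  set c : ℂ := (Real.sqrt (1 - t) : ℂ) with hc
  set s : ℂ := (Real.sqrt t : ℂ) with hs
  have hc2 : c * c = 1 - t := by
    rw [hc, ← Complex.ofReal_mul, Real.mul_self_sqrt (by linarith)]; simp
  have hs2 : s * s = t := by
    rw [hs, ← Complex.ofReal_mul, Real.mul_self_sqrt ht0]
  have hcs : star c = c := by simp [hc]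
  have hss : star s = s := by simp [hs]
  let V : Matrix (Fin n) (Fin n) ℂ := Matrix.of fun b a =>
    if a = j then c * U b j + s * w * U b k
    else if a = k then -(s * star w) * U b j + c * U b k else U b a
  have hVj : Vᵀ j = c • Uᵀ j + (s * w) • Uᵀ k := by
    ext b; simp [V]
  have hVk : Vᵀ k = (-(s * star w)) • Uᵀ j + c • Uᵀ k := by
    ext b; simp [V, hjk.symm]
  have hVa : ∀ a, a ≠ j → a ≠ k → Vᵀ a = Uᵀ a := by
    intro a h1 h2; ext b; simp [V, h1, h2]
  clear_value c s
  rw [Complex.star_def] at hw hwz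
  have hcases : ∀ a, a = j ∨ a = k ∨ (a ≠ j ∧ a ≠ k) := fun a => by tauto
  have hone : ∀ a b, star (Uᵀ a) ⬝ᵥ Uᵀ b = if a = b then 1 else 0 := by
    intro a b
    rw [Matrix.mem_unitaryGroup_iff'] at hU
    exact congrFun₂ hU a b
  refine ⟨V, ?_, fun a => ?_⟩
  · rw [Matrix.mem_unitaryGroup_iff']
    ext a b
    change star (Vᵀ a) ⬝ᵥ Vᵀ b = if a = b then 1 else 0
    rcases hcases a with ha | ha | ⟨ha, ha'⟩ <;> rcases hcases b with hb | hb | ⟨hb, hb'⟩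
    · simp [ha, hb, hVj, hone, hjk, hjk.symm, hcs, hss]
      linear_combination hc2 + hs2 + s * s * hw
    · simp [ha, hb, hVj, hVk, hone, hjk, hjk.symm, hcs, hss]
      ring
    · simp [ha, hVj, hVa b hb hb', hone, Ne.symm hb, Ne.symm hb']
    · simp [ha, hb, hVj, hVk, hone, hjk, hjk.symm, hcs, hss]
      ring
    · simp [ha, hb, hVk, hone, hjk, hjk.symm, hcs, hss]
      linear_combination hc2 + hs2 + s * s * hw
    · simp [ha, hVk, hVa b hb hb', hone, Ne.symm hb, Ne.symm hb']
    · simp [hb, hVj, hVa a ha ha', hone, ha, ha']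
    · simp [hb, hVk, hVa a ha ha', hone, ha, ha']
    · simp [hVa a ha ha', hVa b hb hb', hone]
  · simp only [conjTranspose_mul_mul_apply] at hwz hx ⊢
    rcases hcases a with ha | ha | ⟨ha, ha'⟩
    · simp [ha, hVj, hj, hcs, hss, Matrix.mulVec_add, Matrix.mulVec_smul, hx]
      linear_combination c * s * hwz + x j * hc2 + x k * starRingEnd ℂ w * w * hs2 + x k * t * hw
    · simp [ha, hVk, hk, hcs, hss, Matrix.mulVec_add, Matrix.mulVec_neg, Matrix.mulVec_smul, hx]
      linear_combination -c * s * hwz + x k * hc2 + x j * starRingEnd ℂ w * w * hs2 + x j * t * hw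
    · rw [hVa a ha ha', hy a ha ha', hx]

/-- A property stable under T-transforms passes from `x` to every monotone `y` majorized by `x`. -/
theorem of_sum_Iic_le {n : ℕ} {P : (Fin n → ℝ) → Prop}
    (hP : ∀ x, P x → ∀ j k : Fin n, j ≠ k → ∀ t : ℝ, 0 ≤ t → t ≤ 1 → ∀ y : Fin n → ℝ,
      y j = (1 - t) * x j + t * x k → y k = t * x j + (1 - t) * x k →
      (∀ a, a ≠ j → a ≠ k → y a = x a) → P y)
    {y : Fin n → ℝ} (hy : Monotone y) (x : Fin n → ℝ) (hx : P x)
    (hle : ∀ q, ∑ i ∈ Finset.Iic q, x i ≤ ∑ i ∈ Finset.Iic q, y i)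
    (hsum : ∑ i, x i = ∑ i, y i) : P y := by
  induction hN : (Finset.univ.filter fun i => x i ≠ y i).card using Nat.strong_induction_on
    generalizing x with
  | _ N ih =>
  by_cases hxy : x = y
  · exact hxy ▸ hx
  have hB : (Finset.univ.filter fun i => y i < x i).Nonempty := by
    by_contra hne
    rw [Finset.not_nonempty_iff_eq_empty, Finset.filter_eq_empty_iff] at hne
    refine hxy (funext fun i => ?_)
    exact (Finset.sum_eq_sum_iff_of_le fun i hi => not_lt.1 (hne hi)).1 hsum i (Finset.mem_univ i)
  obtain ⟨k, hk, hmin⟩ : ∃ k, y k < x k ∧ ∀ i < k, x i ≤ y i := by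
    refine ⟨_, (Finset.mem_filter.1 (Finset.min'_mem _ hB)).2, fun i hi => ?_⟩
    by_contra! hlt
    exact (Finset.min'_le _ i (by simpa using hlt)).not_gt hi
  obtain ⟨j, hjk, hj⟩ : ∃ j < k, x j < y j := by
    by_contra! hge
    refine (hle k).not_gt (Finset.sum_lt_sum (fun i hi => ?_) ⟨k, by simp, hk⟩)
    rcases (Finset.mem_Iic.1 hi).lt_or_eq with h | rfl
    · exact hge i h
    · exact hk.le
  have hyjk := hy hjk.le
  set δ := min (y j - x j) (x k - y k) with hδ
  have hδ0 : 0 < δ := lt_min (by linarith) (by linarith)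
  have hδj : δ ≤ y j - x j := min_le_left _ _
  have hδk : δ ≤ x k - y k := min_le_right _ _
  have hd : 0 < x k - x j := by linarith
  let x' : Fin n → ℝ := fun i => x i + (if j = i then δ else 0) - (if k = i then δ else 0)
  have hx'j : x' j = x j + δ := by simp [x', hjk.ne']
  have hx'k : x' k = x k - δ := by simp [x', hjk.ne]
  have hx'a : ∀ a, a ≠ j → a ≠ k → x' a = x a := fun a h1 h2 => by
    simp [x', h1.symm, h2.symm]
  have hx'sum : ∀ A : Finset (Fin n), ∑ i ∈ A, x' i =
      ∑ i ∈ A, x i + (if j ∈ A then δ else 0) - (if k ∈ A then δ else 0) := fun A => by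
    simp [x', Finset.sum_add_distrib, Finset.sum_sub_distrib]
  refine ih _ ?_ x' ?_ (fun q => ?_) ?_ rfl
  · rw [← hN]
    apply Finset.card_lt_card
    rw [Finset.ssubset_iff_of_subset]
    · rcases min_choice (y j - x j) (x k - y k) with h | h
      · exact ⟨j, by simpa using hj.ne, by simp [hx'j, hδ, h]⟩
      · exact ⟨k, by simpa using hk.ne', by simp [hx'k, hδ, h]⟩
    · intro i
      simp only [Finset.mem_filter, Finset.mem_univ, true_and]
      intro hi
      by_cases hij : i = j
      · exact hij ▸ hj.ne
      by_cases hik : i = k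
      · exact hik ▸ hk.ne'
      rwa [hx'a i hij hik] at hi
  · refine hP x hx j k hjk.ne (δ / (x k - x j)) (by positivity) ?_ x' ?_ ?_ hx'a
    · rw [div_le_one hd]; linarith
    · rw [hx'j]; field_simp; ring
    · rw [hx'k]; field_simp; ring
  · have := hle q
    rw [hx'sum]
    simp only [Finset.mem_Iic]
    split_ifs with h1 h2 h2
    · linarith
    · have hs : y j - x j ≤ ∑ i ∈ Finset.Iic q, (y i - x i) :=
        Finset.single_le_sum (f := fun i => y i - x i)
          (fun i hi => sub_nonneg.2 (hmin i ((Finset.mem_Iic.1 hi).trans_lt (not_le.1 h2))))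
          (Finset.mem_Iic.2 h1)
      rw [Finset.sum_sub_distrib] at hs
      linarith
    · exact absurd (hjk.le.trans h2) h1
    · linarith
  · rw [hx'sum]; simpa using hsum

/-- Averaging a monotone vector by a doubly stochastic array increases its initial sums. -/
theorem sum_Iic_le_sum_Iic_doublyStochastic {n : ℕ} {l : Fin n → ℝ} (hl : Monotone l)
    {w : Fin n → Fin n → ℝ} (hw : ∀ a j, 0 ≤ w a j) (hrow : ∀ a, ∑ j, w a j = 1)
    (hcol : ∀ j, ∑ a, w a j = 1) (q : Fin n) :
    ∑ a ∈ Finset.Iic q, l a ≤ ∑ a ∈ Finset.Iic q, ∑ j, w a j * l j := by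
  rw [Finset.sum_comm]
  simp only [← Finset.sum_mul]
  set v : Fin n → ℝ := fun j => ∑ a ∈ Finset.Iic q, w a j with hv
  have hv0 : ∀ j, 0 ≤ v j := fun j => Finset.sum_nonneg fun a _ => hw a j
  have hv1 : ∀ j, v j ≤ 1 := fun j => (hcol j) ▸
    Finset.sum_le_sum_of_subset_of_nonneg (Finset.subset_univ _) fun a _ _ => hw a j
  have hvs : ∑ j, v j = ∑ j, if j ≤ q then (1 : ℝ) else 0 := by
    rw [hv, Finset.sum_comm]
    simp only [hrow]
    rw [← Finset.sum_filter]
    congr 1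
    ext; simp
  have hL : ∑ a ∈ Finset.Iic q, l a = ∑ j, (if j ≤ q then (1 : ℝ) else 0) * l j := by
    simp only [ite_mul, one_mul, zero_mul]
    rw [← Finset.sum_filter]
    congr 1
    ext; simp
  have key : 0 ≤ ∑ j, (v j - if j ≤ q then (1 : ℝ) else 0) * (l j - l q) := by
    refine Finset.sum_nonneg fun j _ => ?_
    split_ifs with h
    · exact mul_nonneg_of_nonpos_of_nonpos (by linarith [hv1 j]) (by linarith [hl h])
    · exact mul_nonneg (by linarith [hv0 j]) (by linarith [hl (not_le.1 h).le])
  simp only [mul_sub, sub_mul, Finset.sum_sub_distrib, ← Finset.sum_mul] at key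
  rw [hL]
  rw [hvs] at key
  linarith

/-- The spectrum, listed increasingly, is an orbit diagonal majorizing all others. -/
theorem Matrix.IsHermitian.exists_isOrbitDiag_majorizing {n : ℕ} {S : Matrix (Fin n) (Fin n) ℂ}
    (hS : S.IsHermitian) :
    ∃ l : Fin n → ℝ, IsOrbitDiag S l ∧ ∀ x, IsOrbitDiag S x →
      (∀ q, ∑ i ∈ Finset.Iic q, l i ≤ ∑ i ∈ Finset.Iic q, x i) ∧ ∑ i, l i = ∑ i, x i := by
  set E := (hS.eigenvectorUnitary : Matrix (Fin n) (Fin n) ℂ)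
  have hE : E ∈ Matrix.unitaryGroup (Fin n) ℂ := hS.eigenvectorUnitary.2
  have hD : Eᴴ * S * E = Matrix.diagonal fun i => (hS.eigenvalues i : ℂ) := by
    simpa [Unitary.conjStarAlgAut_star_apply] using! hS.conjStarAlgAut_star_eigenvectorUnitary
  have hEE : E * Eᴴ = 1 := Matrix.mem_unitaryGroup_iff.1 hE
  set τ := Tuple.sort hS.eigenvalues
  have hE0 : IsOrbitDiag S hS.eigenvalues := ⟨E, hE, fun a => by rw [hD]; simp⟩
  refine ⟨hS.eigenvalues ∘ τ, hE0.comp_perm τ, ?_⟩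
  rintro x ⟨U, hU, hx⟩
  set W := Eᴴ * U with hW
  have hWu : W ∈ Matrix.unitaryGroup (Fin n) ℂ := mul_mem (Unitary.star_mem hE) hU
  have hxW : ∀ a, x a = ∑ j, ‖W (τ j) a‖ ^ 2 * (hS.eigenvalues ∘ τ) j := by
    intro a
    have h1 : Uᴴ * S * U = Wᴴ * (Eᴴ * S * E) * W := by
      rw [hW, Matrix.conjTranspose_mul, Matrix.conjTranspose_conjTranspose]
      calc Uᴴ * S * U = Uᴴ * (E * Eᴴ) * S * (E * Eᴴ) * U := by simp [hEE]
        _ = _ := by simp only [Matrix.mul_assoc]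
    have h2 := hx a
    rw [h1, hD, Matrix.mul_apply] at h2
    simp only [Matrix.mul_diagonal, Matrix.conjTranspose_apply] at h2
    simp only [Function.comp_apply]
    rw [Equiv.sum_comp τ fun j => ‖W j a‖ ^ 2 * hS.eigenvalues j, ← Complex.ofReal_inj, ← h2,
      Complex.ofReal_sum]
    refine Finset.sum_congr rfl fun j _ => ?_
    push_cast
    rw [← Complex.conj_mul', Complex.star_def]
    ring
  have hrow : ∀ a, ∑ j, ‖W (τ j) a‖ ^ 2 = 1 := by
    intro a
    rw [Equiv.sum_comp τ fun j => ‖W j a‖ ^ 2]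
    have := congrFun₂ (Matrix.mem_unitaryGroup_iff'.1 hWu) a a
    rw [Matrix.mul_apply] at this
    simp only [Matrix.star_apply, Complex.star_def, Complex.conj_mul', Matrix.one_apply_eq] at this
    exact_mod_cast this
  have hcol : ∀ j, ∑ a, ‖W (τ j) a‖ ^ 2 = 1 := by
    intro j
    have := congrFun₂ (Matrix.mem_unitaryGroup_iff.1 hWu) (τ j) (τ j)
    rw [Matrix.mul_apply] at this
    simp only [Matrix.star_apply, Complex.star_def, Complex.mul_conj', Matrix.one_apply_eq] at this
    exact_mod_cast this
  constructor
  · intro q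
    simp only [hxW]
    exact sum_Iic_le_sum_Iic_doublyStochastic (Tuple.monotone_sort _) (fun _ _ => by positivity)
      hrow hcol q
  · simp only [hxW]
    rw [Finset.sum_comm]
    simp only [← Finset.sum_mul, hcol, one_mul]

/-- The diagonals of the unitary orbit of a hermitian matrix form a convex set. -/
theorem convex_setOf_isOrbitDiag {n : ℕ} {S : Matrix (Fin n) (Fin n) ℂ} (hS : S.IsHermitian) :
    Convex ℝ {x | IsOrbitDiag S x} := by
  obtain ⟨l, hl, hmaj⟩ := hS.exists_isOrbitDiag_majorizing
  intro x hx y hy s t hs ht hst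
  set z := s • x + t • y with hz
  set σ := Tuple.sort z
  obtain ⟨hx1, hx2⟩ := hmaj _ (IsOrbitDiag.comp_perm hx σ)
  obtain ⟨hy1, hy2⟩ := hmaj _ (IsOrbitDiag.comp_perm hy σ)
  have hzsum : ∀ A : Finset (Fin n), ∑ i ∈ A, (z ∘ σ) i =
      s * ∑ i ∈ A, (x ∘ σ) i + t * ∑ i ∈ A, (y ∘ σ) i := fun A => by
    simp [hz, Finset.sum_add_distrib, Finset.mul_sum]
  have hzσ : IsOrbitDiag S (z ∘ σ) := by
    refine of_sum_Iic_le (P := IsOrbitDiag S)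
      (fun _ h _ _ hjk _ h0 h1 _ hj hk ha => h.transform hS hjk h0 h1 hj hk ha)
      (Tuple.monotone_sort z) l hl (fun q => ?_) ?_
    · rw [hzsum]
      calc ∑ i ∈ Finset.Iic q, l i
          = s * ∑ i ∈ Finset.Iic q, l i + t * ∑ i ∈ Finset.Iic q, l i := by
            rw [← add_mul, hst, one_mul]
        _ ≤ _ := add_le_add (mul_le_mul_of_nonneg_left (hx1 q) hs)
            (mul_le_mul_of_nonneg_left (hy1 q) ht)
    · rw [hzsum, ← hx2, ← hy2, ← add_mul, hst, one_mul]
  have := hzσ.comp_perm σ⁻¹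
  simpa [Function.comp_assoc] using! this

theorem convex_coordCompress_orbit {n m : ℕ} {g : Fin n → Fin m} (hg : Function.Injective g)
    {S : Matrix (Fin n) (Fin n) ℂ} (hS : S.IsHermitian) :
    Convex ℝ {Y : Matrix (Fin n) (Fin n) ℂ |
      ∃ U ∈ Matrix.unitaryGroup (Fin n) ℂ, Y = coordCompress g (Uᴴ * S * U)} := by
  have hset : {Y : Matrix (Fin n) (Fin n) ℂ |
      ∃ U ∈ Matrix.unitaryGroup (Fin n) ℂ, Y = coordCompress g (Uᴴ * S * U)} =
      (fun x : Fin n → ℝ => Matrix.diagonal fun i => (x i : ℂ)) '' {x | IsOrbitDiag S x} := by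
    ext Y
    constructor
    · rintro ⟨U, hU, rfl⟩
      have hre : ∀ a, (Uᴴ * S * U) a a = (((Uᴴ * S * U) a a).re : ℂ) := fun a =>
        ((Matrix.isHermitian_conjTranspose_mul_mul U hS).coe_re_apply_self a).symm
      refine ⟨fun a => ((Uᴴ * S * U) a a).re, ⟨U, hU, hre⟩, ?_⟩
      ext a b
      rw [coordCompress_apply]
      by_cases hab : a = b
      · subst hab
        simpa using (hre a).symm
      · simp [hab, hg.eq_iff]
    · rintro ⟨x, ⟨U, hU, hx⟩, rfl⟩
      refine ⟨U, hU, ?_⟩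
      ext a b
      rw [coordCompress_apply]
      by_cases hab : a = b
      · subst hab
        simp [hx]
      · simp [hab, hg.eq_iff]
  rw [hset]
  refine (convex_setOf_isOrbitDiag hS).is_linear_image (f := fun x : Fin n → ℝ =>
    Matrix.diagonal fun i => (x i : ℂ)) ⟨fun x y => ?_, fun c x => ?_⟩
  · simp [Matrix.diagonal_add]
  · rw [← Matrix.diagonal_smul]
    congr 1
    ext i
    simp

/-- If `g` identifies two indices, the compressed orbit of a rank-one projection is not convex. -/
theorem injective_of_convex_coordCompress_orbit {n m : ℕ} {g : Fin n → Fin m}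
    (h : ∀ S : Matrix (Fin n) (Fin n) ℂ, S.PosSemidef →
        Convex ℝ {Y : Matrix (Fin n) (Fin n) ℂ |
          ∃ U ∈ Matrix.unitaryGroup (Fin n) ℂ, Y = coordCompress g (Uᴴ * S * U)}) :
    Function.Injective g := by
  intro k l hkl
  by_contra hne
  set S : Matrix (Fin n) (Fin n) ℂ := Matrix.diagonal (Pi.single k 1) with hSdef
  have hS : S.PosSemidef := Matrix.PosSemidef.diagonal (by
    intro i
    by_cases hi : i = k <;> simp [hi])
  have hUSU : ∀ (U : Matrix (Fin n) (Fin n) ℂ) a b, (Uᴴ * S * U) a b = star (U k a) * U k b := by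
    intro U a b
    rw [Matrix.mul_apply, Finset.sum_eq_single k]
    · simp [hSdef]
    · intro c _ hc
      simp [hSdef, hc]
    · simp
  set Q : Matrix (Fin n) (Fin n) ℂ := (Equiv.swap k l).permMatrix ℂ with hQdef
  have hQ : Q ∈ Matrix.unitaryGroup (Fin n) ℂ := by
    rw [Matrix.mem_unitaryGroup_iff, Matrix.star_eq_conjTranspose, hQdef,
      Matrix.conjTranspose_permMatrix, ← Matrix.permMatrix_mul]
    simp
  obtain ⟨U, -, hU⟩ := h S hS ⟨1, one_mem _, rfl⟩ ⟨Q, hQ, rfl⟩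
    (show (0 : ℝ) ≤ 1 / 2 by norm_num) (show (0 : ℝ) ≤ 1 / 2 by norm_num) (by norm_num)
  have hkk := congrFun₂ hU k k
  have hll := congrFun₂ hU l l
  have hoff := congrFun₂ hU k l
  simp only [Matrix.add_apply, Matrix.smul_apply, coordCompress_apply, hUSU, hkl, if_true]
    at hkk hll hoff
  simp [hQdef, Equiv.Perm.permMatrix, PEquiv.toMatrix_apply, hne, Ne.symm hne] at hkk hll hoff
  rcases hoff with h0 | h0 <;> simp [h0] at hkk hll

/-- convexity of the compressed unitary orbit characterizes
rank-one coordinate projections.  Here the fiber cardinality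
`(univ.filter (g · = i)).card` is the rank `d(i)` of `P_i`. -/
theorem stmt_2 {n m : ℕ} (g : Fin n → Fin m) (hg_mono : Monotone g)
    (hg_surj : Function.Surjective g) :
    (∀ S : Matrix (Fin n) (Fin n) ℂ, S.PosSemidef →
        Convex ℝ {Y : Matrix (Fin n) (Fin n) ℂ |
          ∃ U ∈ Matrix.unitaryGroup (Fin n) ℂ, Y = coordCompress g (Uᴴ * S * U)}) ↔
      ((∀ i : Fin m, (Finset.univ.filter (fun k : Fin n => g k = i)).card = 1) ∧ m = n) := by
  constructor
  · intro h
    have hg := injective_of_convex_coordCompress_orbit h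
    refine ⟨fun i => ?_, by simpa using (Fintype.card_of_bijective ⟨hg, hg_surj⟩).symm⟩
    obtain ⟨k, rfl⟩ := hg_surj i
    simp [hg.eq_iff, Finset.filter_eq']
  · rintro ⟨h, -⟩ S hS
    refine convex_coordCompress_orbit (fun a b hab => ?_) hS.isHermitian
    exact Finset.card_le_one.1 (h (g b)).le a (by simpa using hab) b (by simp)
end

section
/- Let l = (d(i),c(i))_{i=1}^m with Σ_i d(i)c(i) = n, let A = ⊕_{i=1}^m M_{d(i)}(ℂ)⊗1_{c(i)} ⊆ M_n(ℂ) and let E_A be the trace-preserving conditional expectation onto A. Let B ∈ M_n(ℂ) be positive semidefinite, and let A1 = ⊕_{i=1}^m A_i⊗1_{c(i)} and A2 = ⊕_{i=1}^m A'_i⊗1_{c(i)} be elements of A with A_i, A'_i ∈ M_{d(i)}(ℂ) positive semidefinite and λ(A_i) = λ(A'_i) for every 1 ≤ i ≤ m. Then there exists a contraction V ∈ M_n(ℂ) with E_A(V*BV) = A1 if and only if there exists a contraction V' ∈ M_n(ℂ) with E_A(V'*BV') = A2. In other words, membership of an element of A in E_A(C_n(B)) depends only on the spectra λ(A_1),…,λ(A_m).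 -/
open Matrix
open scoped ComplexOrder

/-- Index type modelling `ℂ^n = ⊕_i ℂ^{c i} ⊗ ℂ^{d i}` (so `n = Σ_i d i · c i`);
matrices over `Idx d c` model `M_n(ℂ)`, and the unital *-subalgebra
`𝒜 = ⊕_i M_{d i}(ℂ) ⊗ 1_{c i}` has spectral list `(d i, c i)_{i=1}^m`. -/
abbrev Idx {m : ℕ} (d c : Fin m → ℕ) : Type := (i : Fin m) × (Fin (c i) × Fin (d i))

/-- The element `⊕_{i=1}^m A_i ⊗ 1_{c i}` of `𝒜 = ⊕_i M_{d i}(ℂ) ⊗ 1_{c i}`. -/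
noncomputable def embedAlg {m : ℕ} (d c : Fin m → ℕ)
    (A : ∀ i, Matrix (Fin (d i)) (Fin (d i)) ℂ) : Matrix (Idx d c) (Idx d c) ℂ :=
  Matrix.of fun p q =>
    if h : p.1 = q.1 then
      if p.2.1 = Fin.cast (congrArg c h).symm q.2.1 then
        A p.1 p.2.2 (Fin.cast (congrArg d h).symm q.2.2)
      else 0
    else 0

/-- The trace preserving conditional expectation `E_𝒜` onto
`𝒜 = ⊕_i M_{d i}(ℂ) ⊗ 1_{c i}`:
`E_𝒜(X) = ⊕_i (1/c i)(Σ_j X_{i,j}) ⊗ 1_{c i}`, where `X_{i,j}` is the `j`-th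
diagonal `d i × d i` block of `X` in the `i`-th group of blocks. -/
noncomputable def EA {m : ℕ} (d c : Fin m → ℕ)
    (X : Matrix (Idx d c) (Idx d c) ℂ) : Matrix (Idx d c) (Idx d c) ℂ :=
  Matrix.of fun p q =>
    if h : p.1 = q.1 then
      if p.2.1 = Fin.cast (congrArg c h).symm q.2.1 then
        (c p.1 : ℂ)⁻¹ * ∑ j : Fin (c p.1),
          X ⟨p.1, (j, p.2.2)⟩ ⟨p.1, (j, Fin.cast (congrArg d h).symm q.2.2)⟩
      else 0
    else 0

namespace Matrix.IsHermitian

/-- Hermitian matrices with the same eigenvalues, counted with multiplicity, are unitarily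
conjugate. -/
theorem exists_unitary_conj_of_eigenvalues_map_eq {n : Type*} [Fintype n] [DecidableEq n]
    {A A' : Matrix n n ℂ} (hA : A.IsHermitian) (hA' : A'.IsHermitian)
    (h : Multiset.map hA.eigenvalues Finset.univ.val =
      Multiset.map hA'.eigenvalues Finset.univ.val) :
    ∃ U ∈ unitaryGroup n ℂ, A' = Uᴴ * A * U := by
  have hev : hA.eigenvalues = hA'.eigenvalues := by
    rw [eigenvalues_eq_eigenvalues_iff, hA.charpoly_eq, hA'.charpoly_eq]
    change (Finset.univ.val.map ((fun x : ℝ => Polynomial.X - Polynomial.C (x : ℂ)) ∘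
      hA.eigenvalues)).prod =
      (Finset.univ.val.map ((fun x : ℝ => Polynomial.X - Polynomial.C (x : ℂ)) ∘
        hA'.eigenvalues)).prod
    rw [← Multiset.map_map, h, Multiset.map_map]
  have h1 := hA.spectral_theorem
  have h2 := hA'.spectral_theorem
  rw [← hev] at h2
  rw [Unitary.conjStarAlgAut_apply] at h1 h2
  generalize hA.eigenvalues = e at h1 h2
  generalize hA.eigenvectorUnitary = P at h1
  generalize hA'.eigenvectorUnitary = Q at h2
  refine ⟨((P * star Q : unitaryGroup n ℂ) : Matrix n n ℂ), (P * star Q).2, ?_⟩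
  have hP : star (P : Matrix n n ℂ) * (P : Matrix n n ℂ) = 1 := Unitary.coe_star_mul_self P
  simp only [h1, h2, ← star_eq_conjTranspose, Submonoid.coe_mul, Unitary.coe_star, star_mul,
    star_star]
  simp only [mul_assoc]
  simp only [← mul_assoc (star (P : Matrix n n ℂ)) (P : Matrix n n ℂ), hP, one_mul]

end Matrix.IsHermitian

theorem IsContraction.mul_unitary {ι : Type*} [Fintype ι] [DecidableEq ι] {V W : Matrix ι ι ℂ}
    (hV : IsContraction V) (hW : W ∈ unitaryGroup ι ℂ) : IsContraction (V * W) := by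
  intro x
  have h : Matrix.toEuclideanLin (V * W) x = toEuclideanLin V (toEuclideanLin W x) := by
    simp [Matrix.toLpLin_apply, mulVec_mulVec]
  rw [h]
  refine (hV _).trans_eq ?_
  rw [← sq_eq_sq₀ (norm_nonneg _) (norm_nonneg _), ← inner_self_eq_norm_sq (𝕜 := ℂ),
    ← inner_self_eq_norm_sq (𝕜 := ℂ)]
  congr 1
  rw [← LinearMap.adjoint_inner_left, ← toEuclideanLin_conjTranspose_eq_adjoint]
  simp [Matrix.toLpLin_apply, mulVec_mulVec, ← star_eq_conjTranspose, hW.1]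

open Kronecker in
theorem embedAlg_eq_blockDiagonal' {m : ℕ} (d c : Fin m → ℕ)
    (A : ∀ i, Matrix (Fin (d i)) (Fin (d i)) ℂ) :
    embedAlg d c A = blockDiagonal' fun i => (1 : Matrix (Fin (c i)) (Fin (c i)) ℂ) ⊗ₖ A i := by
  ext ⟨i, j, a⟩ ⟨i', j', a'⟩
  by_cases h : i = i'
  · subst h
    simp [embedAlg, one_apply]
  · simp [embedAlg, h, blockDiagonal'_apply_ne]

theorem embedAlg_mem_unitaryGroup {m : ℕ} (d c : Fin m → ℕ)
    {U : ∀ i, Matrix (Fin (d i)) (Fin (d i)) ℂ} (hU : ∀ i, U i ∈ unitaryGroup (Fin (d i)) ℂ) :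
    embedAlg d c U ∈ unitaryGroup (Idx d c) ℂ := by
  have h (i : Fin m) : U i * (U i)ᴴ = 1 := (hU i).2
  rw [mem_unitaryGroup_iff, embedAlg_eq_blockDiagonal', star_eq_conjTranspose,
    blockDiagonal'_conjTranspose, ← blockDiagonal'_mul]
  simp only [conjTranspose_kronecker, ← mul_kronecker_mul, conjTranspose_one, mul_one, h,
    one_kronecker_one]
  exact blockDiagonal'_one

/-- The average of the diagonal blocks in the `i`-th group of `X`. -/
noncomputable def blockAverage {m : ℕ} (d c : Fin m → ℕ) (X : Matrix (Idx d c) (Idx d c) ℂ)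
    (i : Fin m) : Matrix (Fin (d i)) (Fin (d i)) ℂ :=
  (c i : ℂ)⁻¹ • ∑ j : Fin (c i), X.submatrix (fun a => ⟨i, (j, a)⟩) (fun a => ⟨i, (j, a)⟩)

theorem EA_eq_embedAlg_blockAverage {m : ℕ} (d c : Fin m → ℕ)
    (X : Matrix (Idx d c) (Idx d c) ℂ) : EA d c X = embedAlg d c (blockAverage d c X) := by
  ext p q
  simp [EA, embedAlg, blockAverage, Matrix.sum_apply]

theorem mul_embedAlg_submatrix {m : ℕ} (d c : Fin m → ℕ) {α : Type*}
    (X : Matrix α (Idx d c) ℂ) (U : ∀ i, Matrix (Fin (d i)) (Fin (d i)) ℂ)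
    {β : Type*} (f : β → α) (i : Fin m) (j : Fin (c i)) :
    (X * embedAlg d c U).submatrix f (fun a => ⟨i, (j, a)⟩) =
      X.submatrix f (fun a => ⟨i, (j, a)⟩) * U i := by
  ext p b
  rw [embedAlg_eq_blockDiagonal']
  simp only [submatrix_apply, mul_apply, Fintype.sum_sigma]
  rw [Finset.sum_eq_single i]
  · simp [Fintype.sum_prod_type, one_apply, blockDiagonal'_apply_eq, ite_mul, mul_ite]
  · intro i' _ hi
    simp [blockDiagonal'_apply_ne _ _ _ hi]
  · simp

theorem blockAverage_conj {m : ℕ} (d c : Fin m → ℕ) (X : Matrix (Idx d c) (Idx d c) ℂ)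
    (U : ∀ i, Matrix (Fin (d i)) (Fin (d i)) ℂ) (i : Fin m) :
    blockAverage d c ((embedAlg d c U)ᴴ * X * embedAlg d c U) i =
      (U i)ᴴ * blockAverage d c X i * U i := by
  have h (j : Fin (c i)) :
      ((embedAlg d c U)ᴴ * X * embedAlg d c U).submatrix
        (fun a => (⟨i, (j, a)⟩ : Idx d c)) (fun a => ⟨i, (j, a)⟩) =
      (U i)ᴴ * X.submatrix (fun a => ⟨i, (j, a)⟩) (fun a => ⟨i, (j, a)⟩) * U i := by
    rw [mul_embedAlg_submatrix]
    congr 1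
    have := congrArg conjTranspose
      (mul_embedAlg_submatrix d c Xᴴ U (fun a => (⟨i, (j, a)⟩ : Idx d c)) i j)
    simpa [conjTranspose_submatrix, conjTranspose_mul] using this
  simp only [blockAverage, h, Matrix.mul_smul, Matrix.smul_mul, Matrix.mul_sum, Matrix.sum_mul]

theorem embedAlg_conj {m : ℕ} (d c : Fin m → ℕ) (A U : ∀ i, Matrix (Fin (d i)) (Fin (d i)) ℂ) :
    (embedAlg d c U)ᴴ * embedAlg d c A * embedAlg d c U =
      embedAlg d c fun i => (U i)ᴴ * A i * U i := by
  simp only [embedAlg_eq_blockDiagonal', blockDiagonal'_conjTranspose, ← blockDiagonal'_mul,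
    conjTranspose_kronecker, ← mul_kronecker_mul, conjTranspose_one, mul_one]

theorem EA_conj {m : ℕ} (d c : Fin m → ℕ) (X : Matrix (Idx d c) (Idx d c) ℂ)
    (U : ∀ i, Matrix (Fin (d i)) (Fin (d i)) ℂ) :
    EA d c ((embedAlg d c U)ᴴ * X * embedAlg d c U) =
      (embedAlg d c U)ᴴ * EA d c X * embedAlg d c U := by
  simp only [EA_eq_embedAlg_blockAverage, embedAlg_conj]
  congr 1
  exact funext (blockAverage_conj d c X U)

theorem exists_contraction_EA_eq_embedAlg_of_eigenvalues_map_eq {m : ℕ} (d c : Fin m → ℕ)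
    (B : Matrix (Idx d c) (Idx d c) ℂ) {A A' : ∀ i, Matrix (Fin (d i)) (Fin (d i)) ℂ}
    (hA : ∀ i, (A i).IsHermitian) (hA' : ∀ i, (A' i).IsHermitian)
    (hspec : ∀ i, Multiset.map (hA i).eigenvalues Finset.univ.val =
      Multiset.map (hA' i).eigenvalues Finset.univ.val)
    (hV : ∃ V, IsContraction V ∧ EA d c (Vᴴ * B * V) = embedAlg d c A) :
    ∃ V, IsContraction V ∧ EA d c (Vᴴ * B * V) = embedAlg d c A' := by
  obtain ⟨V, hV, hE⟩ := hV
  choose U hU hconj using fun i =>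
    (hA i).exists_unitary_conj_of_eigenvalues_map_eq (hA' i) (hspec i)
  refine ⟨V * embedAlg d c U, hV.mul_unitary (embedAlg_mem_unitaryGroup d c hU), ?_⟩
  have h : (V * embedAlg d c U)ᴴ * B * (V * embedAlg d c U) =
      (embedAlg d c U)ᴴ * (Vᴴ * B * V) * embedAlg d c U := by
    simp only [conjTranspose_mul, mul_assoc]
  rw [h, EA_conj, hE, embedAlg_conj, ← funext hconj]

/-- membership in `E_𝒜(C_n(B))` depends only on the spectra:
for positive semidefinite `B` and elements `⊕_i A_i ⊗ 1_{c i}`,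
`⊕_i A'_i ⊗ 1_{c i}` of `𝒜` with the `A_i, A'_i` positive semidefinite and
`λ(A_i) = λ(A'_i)` for every `i`. -/
theorem stmt_6 {m : ℕ} (d c : Fin m → ℕ)
    (B : Matrix (Idx d c) (Idx d c) ℂ) (hB : B.PosSemidef)
    (A A' : ∀ i, Matrix (Fin (d i)) (Fin (d i)) ℂ)
    (hA : ∀ i, (A i).PosSemidef) (hA' : ∀ i, (A' i).PosSemidef)
    (hspec : ∀ i, Multiset.map (hA i).1.eigenvalues Finset.univ.val =
      Multiset.map (hA' i).1.eigenvalues Finset.univ.val) :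
    (∃ V : Matrix (Idx d c) (Idx d c) ℂ, IsContraction V ∧
        EA d c (Vᴴ * B * V) = embedAlg d c A) ↔
      (∃ V' : Matrix (Idx d c) (Idx d c) ℂ, IsContraction V' ∧
        EA d c (V'ᴴ * B * V') = embedAlg d c A') := by
  exact ⟨exists_contraction_EA_eq_embedAlg_of_eigenvalues_map_eq d c B
      (fun i => (hA i).1) (fun i => (hA' i).1) hspec,
    exists_contraction_EA_eq_embedAlg_of_eigenvalues_map_eq d c B
      (fun i => (hA' i).1) (fun i => (hA i).1) fun i => (hspec i).symm⟩
end

section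
/- Let P = {P_1,…,P_m} be a system of coordinate projections in M_n(ℂ). Then the relation A ≺_l B, defined for hermitian A, B ∈ M_n(ℂ) by the existence of unitaries U, V ∈ U(n) with V*AV = C_P(U*BU), is reflexive and antisymmetric modulo unitary equivalence: (1) for every hermitian A ∈ M_n(ℂ) there exist unitaries U, V ∈ U(n) with V*AV = C_P(U*AU); (2) if A ≺_l B and B ≺_l A then A and B are unitarily equivalent, i.e., there exists W ∈ U(n) with A = W*BW. -/
open Matrix
open scoped ComplexOrder

theorem re_trace_conjTranspose_mul_self {ι : Type*} [Fintype ι] (X : Matrix ι ι ℂ) :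
    (Xᴴ * X).trace.re = ∑ b, ∑ a, Complex.normSq (X a b) := by
  simp [Matrix.trace, Matrix.mul_apply, Complex.normSq_apply]

theorem re_trace_coordCompress_le {n m : ℕ} (g : Fin n → Fin m) (X : Matrix (Fin n) (Fin n) ℂ) :
    ((coordCompress g X)ᴴ * coordCompress g X).trace.re ≤ (Xᴴ * X).trace.re := by
  rw [re_trace_conjTranspose_mul_self, re_trace_conjTranspose_mul_self]
  gcongr with b _ a _
  rw [coordCompress_apply]
  split_ifs <;> simp [Complex.normSq_nonneg]

/-- A compression which does not decrease the Frobenius norm acts trivially. -/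
theorem coordCompress_eq_self {n m : ℕ} (g : Fin n → Fin m) (X : Matrix (Fin n) (Fin n) ℂ)
    (h : (Xᴴ * X).trace.re ≤ ((coordCompress g X)ᴴ * coordCompress g X).trace.re) :
    coordCompress g X = X := by
  have key : (((X - coordCompress g X)ᴴ * (X - coordCompress g X)).trace).re =
      (Xᴴ * X).trace.re - ((coordCompress g X)ᴴ * coordCompress g X).trace.re := by
    simp only [re_trace_conjTranspose_mul_self, ← Finset.sum_sub_distrib]
    refine Finset.sum_congr rfl fun b _ => Finset.sum_congr rfl fun a _ => ?_
    rw [Matrix.sub_apply, coordCompress_apply]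
    split_ifs <;> simp
  have hsum : ∑ b, ∑ a, Complex.normSq ((X - coordCompress g X) a b) = 0 := by
    rw [← re_trace_conjTranspose_mul_self]
    refine le_antisymm (by linarith) ?_
    rw [re_trace_conjTranspose_mul_self]
    exact Finset.sum_nonneg fun b _ => Finset.sum_nonneg fun a _ => Complex.normSq_nonneg _
  ext a b
  rw [Finset.sum_eq_zero_iff_of_nonneg
    fun b _ => Finset.sum_nonneg fun a _ => Complex.normSq_nonneg _] at hsum
  have hb := hsum b (Finset.mem_univ b)
  rw [Finset.sum_eq_zero_iff_of_nonneg fun a _ => Complex.normSq_nonneg _] at hb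
  exact (sub_eq_zero.mp (Complex.normSq_eq_zero.mp (hb a (Finset.mem_univ a)))).symm

theorem trace_conjTranspose_mul_self_unitary_conj {ι : Type*} [Fintype ι] [DecidableEq ι]
    {V : Matrix ι ι ℂ} (hV : V ∈ Matrix.unitaryGroup ι ℂ) (A : Matrix ι ι ℂ) :
    ((Vᴴ * A * V)ᴴ * (Vᴴ * A * V)).trace = (Aᴴ * A).trace := by
  have hV' : V * Vᴴ = 1 := Matrix.mem_unitaryGroup_iff.mp hV
  calc ((Vᴴ * A * V)ᴴ * (Vᴴ * A * V)).trace
      = (Vᴴ * (Aᴴ * (V * Vᴴ) * A * V)).trace := by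
        simp only [Matrix.conjTranspose_mul, Matrix.conjTranspose_conjTranspose, Matrix.mul_assoc]
    _ = (Aᴴ * A).trace := by
        rw [Matrix.trace_mul_comm, hV', Matrix.mul_one, Matrix.mul_assoc, hV', Matrix.mul_one]

/-- extended majorization w.r.t. a multiplicity-free list is
reflexive and antisymmetric modulo unitary equivalence. -/
theorem stmt_11 {n m : ℕ} (g : Fin n → Fin m) (hg_mono : Monotone g)
    (hg_surj : Function.Surjective g) :
    (∀ A : Matrix (Fin n) (Fin n) ℂ, A.IsHermitian →
      ∃ U ∈ Matrix.unitaryGroup (Fin n) ℂ, ∃ V ∈ Matrix.unitaryGroup (Fin n) ℂ,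
        Vᴴ * A * V = coordCompress g (Uᴴ * A * U)) ∧
    (∀ A B : Matrix (Fin n) (Fin n) ℂ, A.IsHermitian → B.IsHermitian →
      (∃ U ∈ Matrix.unitaryGroup (Fin n) ℂ, ∃ V ∈ Matrix.unitaryGroup (Fin n) ℂ,
        Vᴴ * A * V = coordCompress g (Uᴴ * B * U)) →
      (∃ U ∈ Matrix.unitaryGroup (Fin n) ℂ, ∃ V ∈ Matrix.unitaryGroup (Fin n) ℂ,
        Vᴴ * B * V = coordCompress g (Uᴴ * A * U)) →
      ∃ W ∈ Matrix.unitaryGroup (Fin n) ℂ, A = Wᴴ * B * W) := by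
  refine ⟨fun A hA => ?_, fun A B _ _ ⟨U, hU, V, hV, h⟩ ⟨U', hU', V', hV', h'⟩ => ?_⟩
  · refine ⟨hA.eigenvectorUnitary, hA.eigenvectorUnitary.2,
      hA.eigenvectorUnitary, hA.eigenvectorUnitary.2, ?_⟩
    have hdiag : (hA.eigenvectorUnitary : Matrix (Fin n) (Fin n) ℂ)ᴴ * A *
        (hA.eigenvectorUnitary : Matrix (Fin n) (Fin n) ℂ) =
        Matrix.diagonal (RCLike.ofReal ∘ hA.eigenvalues) := by
      simpa [Unitary.conjStarAlgAut_apply, Matrix.star_eq_conjTranspose] using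
        hA.conjStarAlgAut_star_eigenvectorUnitary
    rw [hdiag]
    ext a b
    rw [coordCompress_apply]
    by_cases hab : a = b <;> simp [hab]
  · have hBA := re_trace_coordCompress_le g (U'ᴴ * A * U')
    rw [← h', trace_conjTranspose_mul_self_unitary_conj hV',
      trace_conjTranspose_mul_self_unitary_conj hU'] at hBA
    have hfix : coordCompress g (Uᴴ * B * U) = Uᴴ * B * U := by
      apply coordCompress_eq_self
      rw [← h, trace_conjTranspose_mul_self_unitary_conj hV,
        trace_conjTranspose_mul_self_unitary_conj hU]
      exact hBA
    rw [hfix] at h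
    have hVV : V * Vᴴ = 1 := Matrix.mem_unitaryGroup_iff.mp hV
    refine ⟨U * Vᴴ, mul_mem hU (Unitary.star_mem hV), ?_⟩
    calc A = (V * Vᴴ) * A * (V * Vᴴ) := by rw [hVV, Matrix.one_mul, Matrix.mul_one]
      _ = V * (Vᴴ * A * V) * Vᴴ := by simp only [Matrix.mul_assoc]
      _ = (U * Vᴴ)ᴴ * B * (U * Vᴴ) := by
        rw [h]
        simp only [Matrix.conjTranspose_mul, Matrix.conjTranspose_conjTranspose, Matrix.mul_assoc]
end

section
/- Let f : (α,β) → [0,∞) be a monotone convex function and let A ∈ M_n(ℂ) be hermitian with spectrum contained in (α,β). Then for every system of coordinate projections P = {P_1,…,P_m} in M_n(ℂ) and every 1 ≤ i ≤ n, λ_i(f(C_P(A))) ≤ λ_i(C_P(f(A))); in other words, f(C_P(A)) is spectrally dominated by C_P(f(A)) (equivalently, f(C_P(A)) ≺_{l,w} C_P(f(A)) for every multiplicity-free list l). -/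
open Matrix
open scoped ComplexOrder

/-- The real quadratic form `x ↦ re ⟨x, M x⟩` of a matrix. -/
noncomputable def quadForm {n : ℕ} (M : Matrix (Fin n) (Fin n) ℂ) (x : Fin n → ℂ) : ℝ :=
  (star x ⬝ᵥ M *ᵥ x).re

/-- The squared modulus of the `k`-th coordinate of `x` in the eigenbasis of `A`. -/
noncomputable def eigenWeight {n : ℕ} {A : Matrix (Fin n) (Fin n) ℂ} (hA : A.IsHermitian)
    (x : Fin n → ℂ) (k : Fin n) : ℝ :=
  Complex.normSq ((star (hA.eigenvectorUnitary : Matrix (Fin n) (Fin n) ℂ) *ᵥ x) k)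

lemma eigenWeight_nonneg {n : ℕ} {A : Matrix (Fin n) (Fin n) ℂ} (hA : A.IsHermitian)
    (x : Fin n → ℂ) (k : Fin n) : 0 ≤ eigenWeight hA x k :=
  Complex.normSq_nonneg _

lemma matFun_id {n : ℕ} {A : Matrix (Fin n) (Fin n) ℂ} (hA : A.IsHermitian) :
    matFun hA id = A := by
  conv_rhs => rw [hA.spectral_theorem, Unitary.conjStarAlgAut_apply]
  rfl

lemma matFun_one {n : ℕ} {A : Matrix (Fin n) (Fin n) ℂ} (hA : A.IsHermitian) :
    matFun hA (fun _ => 1) = 1 := by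
  simp [matFun]

lemma quadForm_matFun {n : ℕ} {A : Matrix (Fin n) (Fin n) ℂ} (hA : A.IsHermitian) (f : ℝ → ℝ)
    (x : Fin n → ℂ) :
    quadForm (matFun hA f) x = ∑ k, eigenWeight hA x k * f (hA.eigenvalues k) := by
  unfold quadForm matFun eigenWeight
  set U := (hA.eigenvectorUnitary : Matrix (Fin n) (Fin n) ℂ)
  have h : star x ᵥ* U = star (star U *ᵥ x) := by
    rw [star_mulVec, star_eq_conjTranspose, conjTranspose_conjTranspose]
  rw [← mulVec_mulVec, ← mulVec_mulVec, dotProduct_mulVec, h]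
  simp only [dotProduct, mulVec_diagonal, Complex.re_sum, Pi.star_apply]
  refine Finset.sum_congr rfl fun k _ => ?_
  rw [Complex.normSq_apply]
  simp
  ring

lemma sum_eigenWeight {n : ℕ} {A : Matrix (Fin n) (Fin n) ℂ} (hA : A.IsHermitian)
    (x : Fin n → ℂ) : ∑ k, eigenWeight hA x k = ∑ k, Complex.normSq (x k) := by
  have h := quadForm_matFun hA (fun _ => 1) x
  rw [matFun_one] at h
  simp only [mul_one] at h
  rw [← h]
  simp [quadForm, dotProduct, Complex.normSq_apply]

lemma quadForm_eq_sum_eigenvalues {n : ℕ} {A : Matrix (Fin n) (Fin n) ℂ} (hA : A.IsHermitian)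
    (x : Fin n → ℂ) : quadForm A x = ∑ k, eigenWeight hA x k * hA.eigenvalues k := by
  have h := quadForm_matFun hA id x
  rwa [matFun_id] at h

lemma sum_normSq_pos {n : ℕ} {x : Fin n → ℂ} (hx : x ≠ 0) : 0 < ∑ k, Complex.normSq (x k) := by
  obtain ⟨j, hj⟩ := Function.ne_iff.1 hx
  exact Finset.sum_pos' (fun k _ => Complex.normSq_nonneg _)
    ⟨j, Finset.mem_univ _, Complex.normSq_pos.2 hj⟩

lemma quadForm_coordCompress {n m : ℕ} (g : Fin n → Fin m) (X : Matrix (Fin n) (Fin n) ℂ)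
    (x : Fin n → ℂ) :
    quadForm (coordCompress g X) x = ∑ i, quadForm X (coordProj g i *ᵥ x) := by
  unfold quadForm coordCompress
  rw [sum_mulVec, dotProduct_sum, Complex.re_sum]
  refine Finset.sum_congr rfl fun i _ => ?_
  have h : star (coordProj g i *ᵥ x) = star x ᵥ* coordProj g i := by
    rw [star_mulVec, coordProj, diagonal_conjTranspose]
    congr 2
    ext k
    simp only [Pi.star_apply]
    split_ifs <;> simp
  rw [h, ← mulVec_mulVec, ← mulVec_mulVec, dotProduct_mulVec]

lemma coordCompress_one {n m : ℕ} (g : Fin n → Fin m) :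
    coordCompress g (1 : Matrix (Fin n) (Fin n) ℂ) = 1 := by
  ext a b
  simp only [coordCompress, coordProj, mul_one, diagonal_mul_diagonal, Matrix.sum_apply,
    diagonal_apply, one_apply]
  by_cases h : a = b <;> simp [h]

/-- The weight that the compression attaches to the `k`-th eigenvalue of `A`. -/
noncomputable def compressWeight {n m : ℕ} (g : Fin n → Fin m) {A : Matrix (Fin n) (Fin n) ℂ}
    (hA : A.IsHermitian) (x : Fin n → ℂ) (k : Fin n) : ℝ :=
  ∑ i, eigenWeight hA (coordProj g i *ᵥ x) k

lemma compressWeight_nonneg {n m : ℕ} (g : Fin n → Fin m) {A : Matrix (Fin n) (Fin n) ℂ}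
    (hA : A.IsHermitian) (x : Fin n → ℂ) (k : Fin n) : 0 ≤ compressWeight g hA x k :=
  Finset.sum_nonneg fun _ _ => eigenWeight_nonneg _ _ _

lemma quadForm_coordCompress_matFun {n m : ℕ} (g : Fin n → Fin m)
    {A : Matrix (Fin n) (Fin n) ℂ} (hA : A.IsHermitian) (f : ℝ → ℝ) (x : Fin n → ℂ) :
    quadForm (coordCompress g (matFun hA f)) x =
      ∑ k, compressWeight g hA x k * f (hA.eigenvalues k) := by
  simp only [quadForm_coordCompress, quadForm_matFun, compressWeight, Finset.sum_mul]
  exact Finset.sum_comm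

lemma sum_compressWeight {n m : ℕ} (g : Fin n → Fin m) {A : Matrix (Fin n) (Fin n) ℂ}
    (hA : A.IsHermitian) (x : Fin n → ℂ) :
    ∑ k, compressWeight g hA x k = ∑ k, Complex.normSq (x k) := by
  have h := quadForm_coordCompress_matFun g hA (fun _ => 1) x
  rw [matFun_one, coordCompress_one] at h
  simp only [mul_one] at h
  rw [← h]
  simp [quadForm, dotProduct, Complex.normSq_apply]

/-- The Rayleigh quotient of the compression is a weighted mean of the eigenvalues of `A`. -/
lemma centerMass_compressWeight {n m : ℕ} (g : Fin n → Fin m) {A : Matrix (Fin n) (Fin n) ℂ}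
    (hA : A.IsHermitian) (f : ℝ → ℝ) (x : Fin n → ℂ) :
    Finset.univ.centerMass (compressWeight g hA x) (f ∘ hA.eigenvalues) =
      (∑ k, Complex.normSq (x k))⁻¹ * quadForm (coordCompress g (matFun hA f)) x := by
  simp [Finset.centerMass, sum_compressWeight, quadForm_coordCompress_matFun]

lemma rayleigh_coordCompress_mem {n m : ℕ} {s : Set ℝ} (hs : Convex ℝ s) (g : Fin n → Fin m)
    {A : Matrix (Fin n) (Fin n) ℂ} (hA : A.IsHermitian) (hspec : ∀ i, hA.eigenvalues i ∈ s)
    {x : Fin n → ℂ} (hx : x ≠ 0) :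
    (∑ k, Complex.normSq (x k))⁻¹ * quadForm (coordCompress g A) x ∈ s := by
  have h := centerMass_compressWeight g hA id x
  rw [matFun_id] at h
  rw [← h]
  exact hs.centerMass_mem (fun k _ => compressWeight_nonneg g hA x k)
    (by rw [sum_compressWeight]; exact sum_normSq_pos hx) (fun k _ => hspec k)

lemma jensen_rayleigh_coordCompress {n m : ℕ} {s : Set ℝ} {f : ℝ → ℝ} (hf : ConvexOn ℝ s f)
    (g : Fin n → Fin m) {A : Matrix (Fin n) (Fin n) ℂ} (hA : A.IsHermitian)
    (hspec : ∀ i, hA.eigenvalues i ∈ s) {x : Fin n → ℂ} (hx : x ≠ 0) :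
    f ((∑ k, Complex.normSq (x k))⁻¹ * quadForm (coordCompress g A) x) ≤
      (∑ k, Complex.normSq (x k))⁻¹ * quadForm (coordCompress g (matFun hA f)) x := by
  have h := centerMass_compressWeight g hA id x
  rw [matFun_id] at h
  rw [← h, ← centerMass_compressWeight]
  exact hf.map_centerMass_le (fun k _ => compressWeight_nonneg g hA x k)
    (by rw [sum_compressWeight]; exact sum_normSq_pos hx) (fun k _ => hspec k)

/-- The eigenvalues of a compression stay in any convex set containing the spectrum. -/
lemma eigenvalues_coordCompress_mem {n m : ℕ} {s : Set ℝ} (hs : Convex ℝ s) (g : Fin n → Fin m)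
    {A : Matrix (Fin n) (Fin n) ℂ} (hA : A.IsHermitian) (hspec : ∀ i, hA.eigenvalues i ∈ s)
    (hCA : (coordCompress g A).IsHermitian) (j : Fin n) : hCA.eigenvalues j ∈ s := by
  set U := (hCA.eigenvectorUnitary : Matrix (Fin n) (Fin n) ℂ) with hU
  have hUU : star U * U = 1 := Unitary.coe_star_mul_self _
  have hw (k : Fin n) : eigenWeight hCA (U *ᵥ Pi.single j 1) k = if k = j then 1 else 0 := by
    rw [eigenWeight, ← hU, mulVec_mulVec, hUU, one_mulVec, Pi.single_apply]
    split_ifs <;> simp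
  have hsum := sum_eigenWeight hCA (U *ᵥ Pi.single j 1)
  have hq := quadForm_eq_sum_eigenvalues hCA (U *ᵥ Pi.single j 1)
  simp only [hw, ite_mul, one_mul, zero_mul, Finset.sum_ite_eq', Finset.mem_univ, if_true]
    at hsum hq
  have hx : U *ᵥ Pi.single j 1 ≠ 0 := by
    intro h
    simp [h] at hsum
  have h := rayleigh_coordCompress_mem hs g hA hspec hx
  rwa [hq, ← hsum, inv_one, one_mul] at h

/-- If the form of `C` is at least `c` on the span of the eigenvectors of `B` indexed by `S`, then
`C` has at least `#S` eigenvalues that are at least `c`. -/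
lemma card_le_card_eigenvalues_ge {n : ℕ} {B C : Matrix (Fin n) (Fin n) ℂ} (hB : B.IsHermitian)
    (hC : C.IsHermitian) (S : Finset (Fin n)) (c : ℝ)
    (h : ∀ x : Fin n → ℂ, x ≠ 0 → (∀ k ∉ S, eigenWeight hB x k = 0) →
      c * ∑ k, Complex.normSq (x k) ≤ quadForm C x) :
    S.card ≤ (Finset.univ.filter fun k => c ≤ hC.eigenvalues k).card := by
  set T := Finset.univ.filter fun k => c ≤ hC.eigenvalues k with hT
  set U := (hB.eigenvectorUnitary : Matrix (Fin n) (Fin n) ℂ) with hU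
  set V := (hC.eigenvectorUnitary : Matrix (Fin n) (Fin n) ℂ) with hV
  have hUU : star U * U = 1 := Unitary.coe_star_mul_self _
  let ext0 : (S → ℂ) →ₗ[ℂ] (Fin n → ℂ) := LinearMap.pi fun k =>
    if hk : k ∈ S then LinearMap.proj (⟨k, hk⟩ : S) else 0
  let L : (S → ℂ) →ₗ[ℂ] (T → ℂ) :=
    (LinearMap.funLeft ℂ ℂ ((↑) : T → Fin n)) ∘ₗ (star V).mulVecLin ∘ₗ U.mulVecLin ∘ₗ ext0
  have hL : Function.Injective L := by
    rw [injective_iff_map_eq_zero]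
    intro y hy
    set x := U *ᵥ ext0 y with hx
    have hUx : star U *ᵥ x = ext0 y := by
      rw [hx, mulVec_mulVec, hUU, one_mulVec]
    have hx0 : x = 0 := by
      by_contra hne
      have hge := h x hne fun k hk => by
        rw [eigenWeight, ← hU, hUx]
        simp [ext0, hk]
      have hzero (k : Fin n) (hk : k ∈ T) : eigenWeight hC x k = 0 := by
        have := congrFun hy ⟨k, hk⟩
        rw [eigenWeight, Complex.normSq_eq_zero]
        exact this
      have hpos := sum_normSq_pos hne
      rw [← sum_eigenWeight hC] at hpos hge
      rw [quadForm_eq_sum_eigenvalues hC, Finset.mul_sum] at hge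
      obtain ⟨k, -, hk⟩ := (Finset.sum_pos_iff_of_nonneg
        fun k _ => eigenWeight_nonneg hC x k).1 hpos
      refine hge.not_gt (Finset.sum_lt_sum (fun j _ => ?_) ⟨k, Finset.mem_univ _, ?_⟩)
      · by_cases hj : j ∈ T
        · simp [hzero j hj]
        · have : hC.eigenvalues j < c := by simpa [hT] using hj
          nlinarith [eigenWeight_nonneg hC x j]
      · have hkT : k ∉ T := fun hkT => hk.ne' (hzero k hkT)
        have : hC.eigenvalues k < c := by simpa [hT] using hkT
        nlinarith
    have hy0 : ext0 y = 0 := by rw [← hUx, hx0, mulVec_zero]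
    ext ⟨k, hk⟩
    have := congrFun hy0 k
    simpa [ext0, hk] using this
  simpa using LinearMap.finrank_le_finrank_of_injective hL

lemma map_eigenvalues_matFun {n : ℕ} {A : Matrix (Fin n) (Fin n) ℂ} (hA : A.IsHermitian)
    (f : ℝ → ℝ) (hfA : (matFun hA f).IsHermitian) :
    Multiset.map hfA.eigenvalues Finset.univ.val =
      Multiset.map (fun i => f (hA.eigenvalues i)) Finset.univ.val := by
  have h := hfA.roots_charpoly_eq_eigenvalues
  have h' : (matFun hA f).charpoly =
      ∏ i, (Polynomial.X - Polynomial.C ((f (hA.eigenvalues i) : ℝ) : ℂ)) := by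
    rw [matFun, charpoly_mul_comm, ← mul_assoc]
    simp [charpoly_diagonal]
  rw [h', Polynomial.roots_prod _ _
    (by simp [Finset.prod_ne_zero_iff, Polynomial.X_sub_C_ne_zero])] at h
  apply Multiset.map_injective Complex.ofReal_injective
  simp only [Multiset.map_map]
  simpa [Function.comp_def] using h.symm

lemma le_sortedVec_iff {n : ℕ} (x : Fin n → ℝ) (i : Fin n) (c : ℝ) :
    c ≤ sortedVec x i ↔ (i : ℕ) < (Finset.univ.filter fun k => c ≤ x k).card := by
  set l := (Multiset.map x Finset.univ.val).sort (· ≥ ·) with hl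
  have hlen : l.length = n := by simp [hl]
  have hcard : (Finset.univ.filter fun k => c ≤ x k).card = l.countP (fun y => c ≤ y) := by
    rw [← Multiset.coe_countP, hl, Multiset.sort_eq, Multiset.countP_map]
    rfl
  have hsort : l.Pairwise (· ≥ ·) := Multiset.pairwise_sort _ _
  have hi : (i : ℕ) < l.length := hlen.symm ▸ i.2
  have hget : sortedVec x i = l[(i : ℕ)] := rfl
  have hanti {a b : ℕ} (hab : a ≤ b) (hb : b < l.length) : l[b] ≤ l[a] := by
    rcases hab.eq_or_lt with rfl | hab
    · exact le_rfl
    · exact List.pairwise_iff_getElem.1 hsort a b _ hb hab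
  rw [hcard, hget]
  constructor
  · intro hc
    have htake : (l.take (i + 1)).countP (fun y => c ≤ y) = (l.take (i + 1)).length := by
      rw [List.countP_eq_length]
      intro a ha
      obtain ⟨j, hj, rfl⟩ := List.mem_iff_getElem.1 ha
      rw [List.getElem_take]
      simp only [List.length_take] at hj
      simpa using hc.trans (hanti (by omega) hi)
    have := (List.take_sublist (i + 1 : ℕ) l).countP_le (p := fun y => decide (c ≤ y))
    rw [htake, List.length_take] at this
    omega
  · intro hlt
    by_contra! hc
    have hdrop : (l.drop i).countP (fun y => c ≤ y) = 0 := by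
      rw [List.countP_eq_zero]
      intro a ha
      obtain ⟨j, hj, rfl⟩ := List.mem_iff_getElem.1 ha
      rw [List.getElem_drop]
      simp only [List.length_drop] at hj
      simpa using (hanti (Nat.le_add_right (i : ℕ) j) (by omega)).trans_lt hc
    rw [← List.take_append_drop (i : ℕ) l, List.countP_append, hdrop] at hlt
    have := List.countP_le_length (p := fun y => decide (c ≤ y)) (l := l.take i)
    rw [List.length_take] at this
    omega

/-- Jensen's inequality: `f(C_P(A))` is spectrally dominated
by `C_P(f(A))` for monotone convex nonnegative `f` on `(α,β)`.  The hermitian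
witnesses `hCA, hfCA, hCfA` (which always hold) are taken as hypotheses so that
the eigenvalues and `matFun` make sense; `sortedVec h.eigenvalues i` is the
`i`-th largest eigenvalue `λ_i`. -/
theorem stmt_13 {n m : ℕ} (α β : ℝ) (f : ℝ → ℝ)
    (hf_nonneg : ∀ x ∈ Set.Ioo α β, 0 ≤ f x)
    (hf_conv : ConvexOn ℝ (Set.Ioo α β) f)
    (hf_mono : MonotoneOn f (Set.Ioo α β) ∨ AntitoneOn f (Set.Ioo α β))
    (A : Matrix (Fin n) (Fin n) ℂ) (hA : A.IsHermitian)
    (hspec : ∀ i, hA.eigenvalues i ∈ Set.Ioo α β)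
    (g : Fin n → Fin m) (hg_mono : Monotone g) (hg_surj : Function.Surjective g)
    (hCA : (coordCompress g A).IsHermitian)
    (hfCA : (matFun hCA f).IsHermitian)
    (hCfA : (coordCompress g (matFun hA f)).IsHermitian) :
    ∀ i : Fin n, sortedVec hfCA.eigenvalues i ≤ sortedVec hCfA.eigenvalues i := by
  intro i
  set c := sortedVec hfCA.eigenvalues i with hc
  have hsame : sortedVec hfCA.eigenvalues i = sortedVec (fun j => f (hCA.eigenvalues j)) i := by
    simp only [sortedVec, List.get_eq_getElem, map_eigenvalues_matFun hCA f hfCA, Fin.val_cast]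
  have hcount : (i : ℕ) < (Finset.univ.filter fun j => c ≤ f (hCA.eigenvalues j)).card := by
    rw [← le_sortedVec_iff, hc, hsame]
  rw [le_sortedVec_iff]
  refine hcount.trans_le (card_le_card_eigenvalues_ge hCA hCfA _ c fun x hx hsupp => ?_)
  have hquasi : QuasiconcaveOn ℝ (Set.Ioo α β) f :=
    hf_mono.elim (·.quasiconcaveOn (convex_Ioo α β)) (·.quasiconcaveOn (convex_Ioo α β))
  have hpos := sum_normSq_pos hx
  set S := Finset.univ.filter fun j => c ≤ f (hCA.eigenvalues j) with hS
  have hmean : S.centerMass (eigenWeight hCA x) hCA.eigenvalues =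
      (∑ k, Complex.normSq (x k))⁻¹ * quadForm (coordCompress g A) x := by
    rw [Finset.centerMass_subset _ (Finset.subset_univ S) fun k _ hk => hsupp k hk]
    simp [Finset.centerMass, sum_eigenWeight, quadForm_eq_sum_eigenvalues hCA]
  have hSsum : 0 < ∑ k ∈ S, eigenWeight hCA x k := by
    rwa [Finset.sum_subset (Finset.subset_univ S) fun k _ hk => hsupp k hk, sum_eigenWeight]
  have hmem := (hquasi c).centerMass_mem (t := S) (z := hCA.eigenvalues)
    (fun k _ => eigenWeight_nonneg hCA x k) hSsum fun k hk =>
      ⟨eigenvalues_coordCompress_mem (convex_Ioo α β) g hA hspec hCA k, (Finset.mem_filter.1 hk).2⟩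
  rw [hmean] at hmem
  have hle := hmem.2.trans (jensen_rayleigh_coordCompress hf_conv g hA hspec hx)
  rwa [inv_mul_eq_div, le_div_iff₀ hpos] at hle
end

section
/- Let A ∈ M_{d·m}(ℂ) be positive semidefinite, regarded as an m×m array of d×d blocks A = (A_{ij})_{i,j=1}^m, and let P = {P_1,…,P_m} be the system of coordinate projections in M_{d·m}(ℂ) with rank(P_i) = d for all i. Then there exist a unitary U ∈ U(d·m) and a positive semidefinite D ∈ M_d(ℂ) such that C_P(U*AU) = (1/m)(D ⊕ D ⊕ … ⊕ D), the block-diagonal matrix with all m diagonal d×d blocks equal to (1/m)D. -/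
open Matrix
open scoped ComplexOrder

/-- The `i`-th coordinate projection of `M_{d·m}(ℂ)` (matrices indexed by
`Fin m × Fin d`, i.e. `m×m` arrays of `d×d` blocks), of rank `d`. -/
def blockProj {d m : ℕ} (i : Fin m) : Matrix (Fin m × Fin d) (Fin m × Fin d) ℂ :=
  Matrix.diagonal fun p => if p.1 = i then 1 else 0

/-- The compression `C_P(X) = Σ_i P_i X P_i` onto the block diagonal part. -/
noncomputable def blockCompress {d m : ℕ}
    (X : Matrix (Fin m × Fin d) (Fin m × Fin d) ℂ) :
    Matrix (Fin m × Fin d) (Fin m × Fin d) ℂ :=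
  ∑ i : Fin m, blockProj i * X * blockProj i

/-- The block-diagonal matrix `⊕_{j=1}^m δ_{ij} D ∈ M_{d·m}(ℂ)` whose `i`-th
diagonal `d×d` block is `D` and whose other blocks vanish. -/
noncomputable def deltaBlock {d m : ℕ} (i : Fin m) (D : Matrix (Fin d) (Fin d) ℂ) :
    Matrix (Fin m × Fin d) (Fin m × Fin d) ℂ :=
  Matrix.of fun p q => if p.1 = i ∧ q.1 = i then D p.2 q.2 else 0

/-- The normalized Fourier matrix: a unitary matrix whose entries all have the same modulus. -/
theorem exists_unitary_star_mul_self_eq_inv (m : ℕ) :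
    ∃ F ∈ Matrix.unitaryGroup (Fin m) ℂ, ∀ k i, star (F k i) * F k i = (m : ℂ)⁻¹ := by
  cases m with
  | zero => exact ⟨1, one_mem _, fun k => k.elim0⟩
  | succ n =>
    set c : ℂ := (((Real.sqrt ((n + 1 : ℕ) : ℝ))⁻¹ : ℝ) : ℂ) with hc
    have hcc : star c * c = ((n + 1 : ℕ) : ℂ)⁻¹ := by
      rw [hc, Complex.star_def, Complex.conj_ofReal, ← Complex.ofReal_mul, ← mul_inv,
        Real.mul_self_sqrt (Nat.cast_nonneg _), Complex.ofReal_inv, Complex.ofReal_natCast]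
    have hn : ((n + 1 : ℕ) : ℂ) ≠ 0 := Nat.cast_ne_zero.mpr n.succ_ne_zero
    let F : Matrix (ZMod (n + 1)) (ZMod (n + 1)) ℂ :=
      Matrix.of fun k i => c * ZMod.stdAddChar (k * i)
    have hF (k i j : ZMod (n + 1)) : star (F k i) * F k j =
        ((n + 1 : ℕ) : ℂ)⁻¹ * ZMod.stdAddChar (k * (j - i)) := by
      rw [← hcc, mul_sub, sub_eq_neg_add, AddChar.map_add_eq_mul, AddChar.map_neg_eq_conj]
      simp only [F, Matrix.of_apply, star_mul', Complex.star_def]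
      ring
    have hF_diag (k i : ZMod (n + 1)) : star (F k i) * F k i = ((n + 1 : ℕ) : ℂ)⁻¹ := by
      rw [hF, sub_self, mul_zero, AddChar.map_zero_eq_one, mul_one]
    refine ⟨F, mem_unitaryGroup_iff'.mpr ?_, fun k i => ?_⟩
    · change star F * F = (1 : Matrix (ZMod (n + 1)) (ZMod (n + 1)) ℂ)
      ext i j
      simp only [Matrix.mul_apply, Matrix.star_apply, hF, ← Finset.mul_sum]
      rw [AddChar.sum_mulShift _ (ZMod.isPrimitive_stdAddChar (n + 1)), ZMod.card,
        Matrix.one_apply]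
      by_cases h : i = j
      · simpa [h] using inv_mul_cancel₀ hn
      · simp [h, sub_eq_zero, Ne.symm h]
    · exact hF_diag k i

theorem blockCompress_apply {d m : ℕ} (X : Matrix (Fin m × Fin d) (Fin m × Fin d) ℂ)
    (p q : Fin m × Fin d) :
    blockCompress X p q = if p.1 = q.1 then X p q else 0 := by
  simp only [blockCompress, blockProj, Matrix.sum_apply, Matrix.mul_diagonal,
    Matrix.diagonal_mul]
  by_cases h : p.1 = q.1
  · simp [h]
  · simp [h, eq_comm]

/-- a non-commutative Horn lemma, first part: for positive
semidefinite `A ∈ M_{d·m}(ℂ)` there are a unitary `U` and a positive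
semidefinite `D ∈ M_d(ℂ)` with `C_P(U*AU) = (1/m)(D ⊕ ⋯ ⊕ D)`. -/
theorem stmt_17 {d m : ℕ} (A : Matrix (Fin m × Fin d) (Fin m × Fin d) ℂ)
    (hA : A.PosSemidef) :
    ∃ U ∈ Matrix.unitaryGroup (Fin m × Fin d) ℂ,
      ∃ D : Matrix (Fin d) (Fin d) ℂ, D.PosSemidef ∧
        blockCompress (Uᴴ * A * U) =
          Matrix.of fun p q : Fin m × Fin d =>
            if p.1 = q.1 then (m : ℂ)⁻¹ * D p.2 q.2 else 0 := by
  obtain ⟨F, hF, hFm⟩ := exists_unitary_star_mul_self_eq_inv m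
  let V : Matrix (Fin m × Fin d) (Fin m × Fin d) ℂ := hA.isHermitian.eigenvectorUnitary
  let ev := hA.isHermitian.eigenvalues
  let W : Matrix (Fin m × Fin d) (Fin m × Fin d) ℂ := kroneckerMap (· * ·) F 1
  have hW : W ∈ Matrix.unitaryGroup (Fin m × Fin d) ℂ :=
    kronecker_mem_unitary hF (one_mem _)
  have hV : Vᴴ * A * V = diagonal fun p => (ev p : ℂ) := by
    have := hA.isHermitian.conjStarAlgAut_star_eigenvectorUnitary
    simpa [V, ev, Unitary.conjStarAlgAut_apply, Function.comp_def, star_eq_conjTranspose] using this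
  refine ⟨V * W, mul_mem hA.isHermitian.eigenvectorUnitary.2 hW,
    diagonal fun a => ∑ k, (ev (k, a) : ℂ), ?_, ?_⟩
  · exact PosSemidef.diagonal fun a => Finset.sum_nonneg fun k _ =>
      Complex.zero_le_real.mpr (hA.eigenvalues_nonneg (k, a))
  · have hconj : (V * W)ᴴ * A * (V * W) =
        Wᴴ * (diagonal fun p => (ev p : ℂ)) * W := by
      rw [← hV, conjTranspose_mul]
      simp only [Matrix.mul_assoc]
    ext ⟨i, a⟩ ⟨j, b⟩
    rw [blockCompress_apply, hconj, Matrix.of_apply]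
    split_ifs with h
    · obtain rfl : i = j := h
      rw [Matrix.mul_apply, Fintype.sum_prod_type]
      simp only [Matrix.mul_diagonal, conjTranspose_apply, W, kroneckerMap_apply, star_mul',
        Matrix.one_apply]
      rw [Matrix.diagonal_apply, mul_ite, Finset.mul_sum, mul_zero]
      split_ifs with hab
      · subst hab
        refine Finset.sum_congr rfl fun k _ => ?_
        rw [← hFm k i, Finset.sum_eq_single a (fun c _ hc => by simp [hc]) (by simp)]
        simp
        ring
      · refine Finset.sum_eq_zero fun k _ => Finset.sum_eq_zero fun c _ => ?_
        by_cases hc : c = a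
        · simp [hc, hab]
        · simp [hc]
    · rfl
end
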